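/- arXiv:2409.06658 — 2 statements merged into one kernel-verified Lean document; each statement's English description precedes it below -/
import Mathlib

section
/- Let s ∈ ℤ and let λ, x₁, x₂, x₃ ∈ ℂ with x₁ + x₂ + x₃ = s and Re(λ + 1 − s) > 0. For each integer k ≥ 0 let ξ_k^+, ξ_k^− ∈ ℂ be any numbers satisfying ξ_k^+ + ξ_k^− = 2 − s − k and ξ_k^+ ξ_k^− = ((2−s−k)/2)² − ((s+k−2λ)/2)² − (x₁−λ)(x₂−λ)(x₃−λ)/(λ+k). Assume x₁, x₂, x₃ and λ are not nonpositive integers, 1 − x₁, 1 − x₂, 1 − x₃ are not nonpositive integers, and suitable genericity holds so that all terms below are defined (in particular ξ_k^± are such that the generalized Pochhammer symbols (ξ_k^±)_{k+s−1} are defined for all k ≥ 0). Then the series ∑_{k=0}^{∞} [ (−1)^{s+1} (−1)^{k+s−1} (ξ_k^+)_{k+s−1} (ξ_k^−)_{k+s−1} / (k!)² ] · ( 1/(x₁+k) + 1/(x₂+k) + 1/(x₃+k) − 1/(λ+k) ) converges and its sum equals Γ(x₁)Γ(x₂)Γ(x₃) / ( Γ(1−x₁)Γ(1−x₂)Γ(1−x₃)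 ). (When ξ_k = (2−s−k)/2 + √( ((s+k−2λ)/2)² + (x₁−λ)(x₂−λ)(x₃−λ)/(λ+k) ) this summand equals (−1)^{s+1}(ξ_k)_{k+s−1}²/(k!)².) -/
open Finset Filter Topology Complex

/-- The generalized Pochhammer symbol `(z)_m` for integer `m`:
`(z)_m = z(z+1)⋯(z+m-1)` for `m ≥ 0` and
`(z)_m = 1/((z-1)(z-2)⋯(z+m))` for `m < 0`. -/
noncomputable def gpoch (z : ℂ) (m : ℤ) : ℂ :=
  if 0 ≤ m then ∏ j ∈ Finset.range m.toNat, (z + j)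
  else (∏ j ∈ Finset.range (-m).toNat, (z - 1 - j))⁻¹


noncomputable def vq (lam x₁ x₂ x₃ : ℂ) (k : ℕ) (z : ℂ) : ℂ :=
  (z - lam) * (z - (x₁ + x₂ + x₃) - k + lam) - (x₁ - lam) * (x₂ - lam) * (x₃ - lam) / (lam + k)

noncomputable def vW (s : ℤ) (lam x₁ x₂ x₃ : ℂ) (k : ℕ) : ℂ :=
  if 0 ≤ (k : ℤ) + s - 1 then ∏ j ∈ range ((k : ℤ) + s - 1).toNat, vq lam x₁ x₂ x₃ k (j + 1)
  else (∏ j ∈ range (-((k : ℤ) + s - 1)).toNat, vq lam x₁ x₂ x₃ k (-j))⁻¹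

noncomputable def vtau (s : ℤ) (lam x₁ x₂ x₃ : ℂ) (n k : ℕ) : ℂ :=
  if 0 ≤ (k : ℤ) + s - 1 then (∏ j ∈ range ((k : ℤ) + s).toNat, vq lam x₁ x₂ x₃ k (n + 1 + j))⁻¹
  else ∏ j ∈ range (-((k : ℤ) + s)).toNat, vq lam x₁ x₂ x₃ k (-(n + 1 + j))

theorem vq_symm (lam x₁ x₂ x₃ : ℂ) (k : ℕ) (z w : ℂ) (h : z + w = x₁ + x₂ + x₃ + k) :
    vq lam x₁ x₂ x₃ k z = vq lam x₁ x₂ x₃ k w := by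
  have : w = x₁ + x₂ + x₃ + k - z := by linear_combination h
  subst this
  unfold vq; ring

theorem vcancel (s : ℤ) (lam x₁ x₂ x₃ : ℂ) (hx : x₁ + x₂ + x₃ = (s : ℂ)) (n k : ℕ)
    (h1 : ∀ j < ((k : ℤ) + s).toNat, vq lam x₁ x₂ x₃ k (n + 1 + j) ≠ 0)
    (h2 : ∀ j < (-((k : ℤ) + s - 1)).toNat, vq lam x₁ x₂ x₃ k (-j) ≠ 0) :
    ∏ j ∈ range n, vq lam x₁ x₂ x₃ k (j + 1)
      = vW s lam x₁ x₂ x₃ k * vtau s lam x₁ x₂ x₃ n k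
        * ∏ j ∈ range (n + 1), vq lam x₁ x₂ x₃ k (-j) := by
  unfold vW vtau
  split_ifs with h
  · obtain ⟨m, hm⟩ := Int.eq_ofNat_of_zero_le h
    have e1 : ((k : ℤ) + s - 1).toNat = m := by omega
    have e2 : ((k : ℤ) + s).toNat = m + 1 := by omega
    have hs : (s : ℂ) = m + 1 - k := by
      have : s = m + 1 - k := by omega
      rw [this]; push_cast; ring
    rw [e2] at h1
    rw [e1, e2]
    have hne : ∏ j ∈ range (m + 1), vq lam x₁ x₂ x₃ k (n + 1 + j) ≠ 0 :=
      prod_ne_zero_iff.2 fun j hj => h1 j (mem_range.1 hj)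
    rw [mul_assoc, mul_left_comm, ← div_eq_inv_mul, eq_div_iff hne]
    have a1 := prod_range_add (fun j : ℕ => vq lam x₁ x₂ x₃ k ((j : ℂ) + 1)) n (m + 1)
    have a2 := prod_range_add (fun j : ℕ => vq lam x₁ x₂ x₃ k ((j : ℂ) + 1)) m (n + 1)
    have e : n + (m + 1) = m + (n + 1) := by ring
    rw [e, a2] at a1
    convert a1.symm using 2
    · refine prod_congr rfl fun j _ => ?_
      congr 1; push_cast; ring
    · refine prod_congr rfl fun j _ => vq_symm _ _ _ _ _ _ _ ?_
      rw [hx, hs]; push_cast; ring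
  · obtain ⟨m, hm⟩ := Int.eq_ofNat_of_zero_le (show 0 ≤ -((k : ℤ) + s) by omega)
    have e1 : (-((k : ℤ) + s - 1)).toNat = m + 1 := by omega
    have e2 : (-((k : ℤ) + s)).toNat = m := by omega
    have hs : (s : ℂ) = - m - k := by
      have : s = - m - k := by omega
      rw [this]; push_cast; ring
    rw [e1] at h2
    rw [e1, e2]
    have hne : ∏ j ∈ range (m + 1), vq lam x₁ x₂ x₃ k (-j) ≠ 0 :=
      prod_ne_zero_iff.2 fun j hj => h2 j (mem_range.1 hj)
    rw [mul_assoc, ← div_eq_inv_mul, eq_div_iff hne]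
    have a1 := prod_range_add (fun j : ℕ => vq lam x₁ x₂ x₃ k (-(j : ℂ))) (n + 1) m
    have a2 := prod_range_add (fun j : ℕ => vq lam x₁ x₂ x₃ k (-(j : ℂ))) (m + 1) n
    have e : (n + 1) + m = (m + 1) + n := by ring
    rw [e, a2] at a1
    rw [mul_comm, mul_comm (∏ j ∈ range m, _)]
    convert a1 using 2
    · refine prod_congr rfl fun j _ => vq_symm _ _ _ _ _ _ _ ?_
      rw [hx, hs]; push_cast; ring
    · refine prod_congr rfl fun j _ => ?_
      congr 1; push_cast; ring

/-- B_k -/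
theorem vB (lam x₁ x₂ x₃ : ℂ) (k : ℕ) (h1 : x₁ + k ≠ 0) (h2 : x₂ + k ≠ 0) (h3 : x₃ + k ≠ 0)
    (hl : lam + k ≠ 0) :
    1 / (x₁ + k) + 1 / (x₂ + k) + 1 / (x₃ + k) - 1 / (lam + k)
      = vq lam x₁ x₂ x₃ k (-k) / ((x₁ + k) * (x₂ + k) * (x₃ + k)) := by
  unfold vq
  field_simp
  ring

theorem vP (lam x₁ x₂ x₃ : ℂ) (k : ℕ) (z : ℂ) (hl : lam + k ≠ 0) :
    (z - x₁) * (z - x₂) * (z - x₃) - (x₁ + k) * (x₂ + k) * (x₃ + k) / (lam + k) * (z - lam)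
      = (z + k) * vq lam x₁ x₂ x₃ k z := by
  unfold vq
  field_simp
  ring

noncomputable def vR (x₁ x₂ x₃ : ℂ) (n : ℕ) : ℂ :=
  (∏ j ∈ range n, ((j + 1 - x₁) * (j + 1 - x₂) * (j + 1 - x₃)))
    / ∏ j ∈ range (n + 1), ((x₁ + j) * (x₂ + j) * (x₃ + j))

open Polynomial in
theorem vlagrange (lam x₁ x₂ x₃ : ℂ) (n : ℕ)
    (h1 : ∀ j : ℕ, x₁ + j ≠ 0) (h2 : ∀ j : ℕ, x₂ + j ≠ 0) (h3 : ∀ j : ℕ, x₃ + j ≠ 0)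
    (hl : ∀ j : ℕ, lam + j ≠ 0)
    (hq : ∀ k ≤ n, ∀ j ≤ n, vq lam x₁ x₂ x₃ k (-j) ≠ 0) :
    vR x₁ x₂ x₃ n = ∑ k ∈ range (n + 1),
      (∏ j ∈ range n, ((j + 1 + k) * vq lam x₁ x₂ x₃ k (j + 1)))
      / (∏ j ∈ (range (n + 1)).erase k, ((j - k) * vq lam x₁ x₂ x₃ k (-j)))
      / ((x₁ + k) * (x₂ + k) * (x₃ + k)) := by
  set y : ℕ → ℂ := fun k => -((x₁ + k) * (x₂ + k) * (x₃ + k) / (lam + k)) with hy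
  set N : ℂ[X] := ∏ j ∈ range n, (C (((j : ℂ) + 1 - x₁) * (j + 1 - x₂) * (j + 1 - x₃)) + C ((j : ℂ) + 1 - lam) * X) with hN
  have hdiff : ∀ k j : ℕ, y k - y j = (j - k) * vq lam x₁ x₂ x₃ k (-j) / (lam + j) := by
    intro k j
    have := vP lam x₁ x₂ x₃ k (-j) (hl k)
    have hlj := hl j
    rw [eq_div_iff hlj]
    have e : y j * (lam + j) = -((x₁ + j) * (x₂ + j) * (x₃ + j)) := by
      simp only [hy]; field_simp
    have e2 : y k = -((x₁ + k) * (x₂ + k) * (x₃ + k) / (lam + k)) := rfl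
    rw [sub_mul, e, e2]
    linear_combination -this
  have hinj : Set.InjOn y (range (n + 1) : Finset ℕ) := by
    intro k hk j hj hkj
    by_contra hne
    have := hdiff k j
    rw [hkj, sub_self, eq_comm, div_eq_zero_iff] at this
    have hk' : k ≤ n := by simpa [Nat.lt_succ_iff] using hk
    have hj' : j ≤ n := by simpa [Nat.lt_succ_iff] using hj
    rcases this with h | h
    · rcases mul_eq_zero.1 h with h | h
      · exact hne (by exact_mod_cast (sub_eq_zero.1 h).symm)
      · exact hq k hk' j hj' h
    · exact hl j h
  have hdeg : N.degree < (range (n + 1)).card := by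
    rw [card_range]
    refine lt_of_le_of_lt (degree_prod_le _ _) ?_
    refine lt_of_le_of_lt (sum_le_sum (g := fun _ => (1 : WithBot ℕ)) fun j _ => ?_) ?_
    · rw [add_comm]; exact degree_linear_le
    · simp
      exact_mod_cast Nat.lt_succ_self n
  have hinterp := Lagrange.eq_interpolate hinj hdeg
  have hy0 : ∀ k, y k ≠ 0 := by
    intro k
    simp only [hy]
    exact neg_ne_zero.2 (div_ne_zero (mul_ne_zero (mul_ne_zero (h1 k) (h2 k)) (h3 k)) (hl k))
  have hev := Lagrange.eval_interpolate_not_at_node (s := range (n + 1)) (v := y) (fun i => N.eval (y i)) (x := 0)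
    (fun i _ => (hy0 i).symm)
  rw [← hinterp] at hev
  have hN0 : N.eval 0 = ∏ j ∈ range n, (((j : ℂ) + 1 - x₁) * (j + 1 - x₂) * (j + 1 - x₃)) := by
    simp [hN, eval_prod]
  have hNk : ∀ k, N.eval (y k) = ∏ j ∈ range n, ((j + 1 + k) * vq lam x₁ x₂ x₃ k (j + 1)) := by
    intro k
    rw [hN, eval_prod]
    refine prod_congr rfl fun j _ => ?_
    rw [← vP _ _ _ _ _ _ (hl k)]
    simp [hy]
    ring
  have hD : ∏ j ∈ range (n + 1), ((x₁ + j) * (x₂ + j) * (x₃ + j)) ≠ 0 :=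
    prod_ne_zero_iff.2 fun j _ => mul_ne_zero (mul_ne_zero (h1 j) (h2 j)) (h3 j)
  have hL : ∏ j ∈ range (n + 1), (lam + j) ≠ 0 :=
    prod_ne_zero_iff.2 fun j _ => hl j
  have hnod : eval 0 (Lagrange.nodal (range (n + 1)) y) = (∏ j ∈ range (n + 1), ((x₁ + j) * (x₂ + j) * (x₃ + j))) / ∏ j ∈ range (n + 1), (lam + j) := by
    rw [Lagrange.eval_nodal, ← prod_div_distrib]
    refine prod_congr rfl fun j _ => ?_
    simp [hy]
  rw [vR, div_eq_iff hD, ← hN0, hev, hnod, div_mul_eq_mul_div, mul_div_assoc, mul_comm]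
  congr 1
  rw [div_eq_iff hL, sum_mul]
  refine sum_congr rfl fun k hk => ?_
  rw [hNk, ← mul_prod_erase _ _ hk, Lagrange.nodalWeight]
  have : ∏ j ∈ (range (n + 1)).erase k, (y k - y j)⁻¹ = (∏ j ∈ (range (n + 1)).erase k, (lam + j)) / ∏ j ∈ (range (n + 1)).erase k, ((j - k) * vq lam x₁ x₂ x₃ k (-j)) := by
    rw [← prod_div_distrib]
    refine prod_congr rfl fun j _ => ?_
    rw [hdiff, inv_div]
  rw [this]
  have e3 : (0 - y k)⁻¹ = (lam + k) / ((x₁ + k) * (x₂ + k) * (x₃ + k)) := by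
    simp [hy]
  rw [e3]
  ring

theorem vfact1 (n k : ℕ) : (∏ j ∈ range n, ((j : ℂ) + 1 + k)) = (n + k).factorial / k.factorial := by
  rw [eq_div_iff (by exact_mod_cast k.factorial_ne_zero)]
  induction n with
  | zero => simp
  | succ n ih =>
    rw [prod_range_succ, mul_right_comm, ih, show n + 1 + k = (n + k) + 1 by ring, Nat.factorial_succ]
    push_cast; ring

theorem vfact2 (n k : ℕ) (hk : k ≤ n) : (∏ j ∈ (range (n + 1)).erase k, ((j : ℂ) - k))
    = (-1) ^ k * k.factorial * (n - k).factorial := by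
  obtain ⟨d, rfl⟩ := Nat.exists_eq_add_of_le hk
  have : (range (k + d + 1)).erase k = range k ∪ (range d).map (addLeftEmbedding (k + 1)) := by
    ext j
    simp only [mem_erase, mem_range, mem_union, Finset.mem_map, addLeftEmbedding_apply]
    constructor
    · rintro ⟨h1, h2⟩
      rcases lt_or_gt_of_ne h1 with h | h
      · exact Or.inl h
      · exact Or.inr ⟨j - k - 1, by omega, by omega⟩
    · rintro (h | ⟨a, ha, rfl⟩) <;> omega
  rw [this, prod_union, prod_map]
  · have e1 : ∏ j ∈ range k, ((j : ℂ) - k) = (-1) ^ k * k.factorial := by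
      rw [← prod_range_reflect]
      have := prod_range_add_one_eq_factorial k
      rw [← this]
      push_cast
      rw [← card_range k, ← prod_const, card_range, ← prod_mul_distrib]
      refine prod_congr rfl fun j hj => ?_
      have : j < k := mem_range.1 hj
      rw [Nat.sub_sub, Nat.cast_sub (by omega)]
      push_cast; ring
    rw [e1]
    congr 1
    have := prod_range_add_one_eq_factorial d
    rw [Nat.add_sub_cancel_left, ← this]
    push_cast
    refine prod_congr rfl fun j hj => ?_
    rw [addLeftEmbedding_apply]
    push_cast
    ring
  · rw [disjoint_left]
    simp only [mem_range, Finset.mem_map, addLeftEmbedding_apply, not_exists, not_and]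
    intros; omega

theorem vgeneric (s : ℤ) (lam x₁ x₂ x₃ : ℂ) (hx : x₁ + x₂ + x₃ = (s : ℂ)) (n : ℕ)
    (h1 : ∀ j : ℕ, x₁ + j ≠ 0) (h2 : ∀ j : ℕ, x₂ + j ≠ 0) (h3 : ∀ j : ℕ, x₃ + j ≠ 0)
    (hl : ∀ j : ℕ, lam + j ≠ 0)
    (hq : ∀ k ≤ n, ∀ j ≤ n, vq lam x₁ x₂ x₃ k (-j) ≠ 0)
    (hq1 : ∀ k ≤ n, ∀ j < ((k : ℤ) + s).toNat, vq lam x₁ x₂ x₃ k (n + 1 + j) ≠ 0)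
    (hq2 : ∀ k ≤ n, ∀ j < (-((k : ℤ) + s - 1)).toNat, vq lam x₁ x₂ x₃ k (-j) ≠ 0) :
    vR x₁ x₂ x₃ n = ∑ k ∈ range (n + 1),
      ((-1) ^ k * vW s lam x₁ x₂ x₃ k / (k.factorial : ℂ) ^ 2
        * (1 / (x₁ + k) + 1 / (x₂ + k) + 1 / (x₃ + k) - 1 / (lam + k)))
      * ((n + k).factorial / (n - k).factorial * vtau s lam x₁ x₂ x₃ n k) := by
  rw [vlagrange lam x₁ x₂ x₃ n h1 h2 h3 hl hq]
  refine sum_congr rfl fun k hk => ?_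
  have hk' : k ≤ n := by simpa [Nat.lt_succ_iff] using hk
  rw [vB _ _ _ _ _ (h1 k) (h2 k) (h3 k) (hl k), prod_mul_distrib, prod_mul_distrib, vfact1, vfact2 _ _ hk',
    vcancel s lam x₁ x₂ x₃ hx n k (hq1 k hk') (hq2 k hk'), ← mul_prod_erase _ _ hk]
  have hne : ∏ j ∈ (range (n + 1)).erase k, vq lam x₁ x₂ x₃ k (-j) ≠ 0 :=
    prod_ne_zero_iff.2 fun j hj => hq k hk' j (by
      have := mem_range.1 (mem_of_mem_erase hj); omega)
  have f1 : (k.factorial : ℂ) ≠ 0 := by exact_mod_cast k.factorial_ne_zero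
  have f2 : ((n - k).factorial : ℂ) ≠ 0 := by exact_mod_cast (n-k).factorial_ne_zero
  have f3 : (-1 : ℂ) ^ k * (-1) ^ k = 1 := by rw [← mul_pow]; simp
  have f4 : ((-1 : ℂ) ^ k)  ≠ 0 := by simp
  have := h1 k
  have := h2 k
  have := h3 k
  generalize hg1 : (-1 : ℂ) ^ k = e at *
  generalize (∏ j ∈ (range (n + 1)).erase k, vq lam x₁ x₂ x₃ k (-j)) = Q at *
  field_simp
  rw [pow_two, f3]; ring


theorem vev_ne (l a : ℂ) : ∀ᶠ z in 𝓝[≠] l, z ≠ a := by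
  by_cases h : l = a
  · subst h; exact self_mem_nhdsWithin
  · exact (eventually_ne_nhds h).filter_mono nhdsWithin_le_nhds

theorem vq_cont (lam x₁ x₂ x₃ : ℂ) (k : ℕ) (z : ℂ) (hl : lam + k ≠ 0) :
    ContinuousAt (fun l => vq l x₁ x₂ x₃ k z) lam := by
  unfold vq
  fun_prop (disch := assumption)

theorem vq_ev (lam x₁ x₂ x₃ : ℂ) (k j : ℕ)
    (h1 : x₁ + k ≠ 0) (h2 : x₂ + k ≠ 0) (h3 : x₃ + k ≠ 0) :
    ∀ᶠ l in 𝓝[≠] lam, vq l x₁ x₂ x₃ k (-j) ≠ 0 := by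
  set α : ℂ := (j + k) * (x₁ + x₂ + x₃ + j + k) - j * k + (x₁ * x₂ + x₁ * x₃ + x₂ * x₃) with hα
  set β : ℂ := j * k * (x₁ + x₂ + x₃ + k + j) - x₁ * x₂ * x₃ with hβ
  have key : ∀ l : ℂ, l + k ≠ 0 → (l + k) * vq l x₁ x₂ x₃ k (-j) = α * l + β := by
    intro l hl
    unfold vq
    rw [hα, hβ]
    field_simp
    ring
  have hb : α * (-k) + β ≠ 0 := by
    have : α * (-k) + β = -((x₁ + k) * (x₂ + k) * (x₃ + k)) := by rw [hα, hβ]; ring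
    rw [this]
    exact neg_ne_zero.2 (mul_ne_zero (mul_ne_zero h1 h2) h3)
  filter_upwards [vev_ne lam (-k), vev_ne lam (-β / α)] with l hl1 hl2 h0
  have hl : l + k ≠ 0 := fun h => hl1 (by linear_combination h)
  have := key l hl
  rw [h0, mul_zero] at this
  by_cases ha : α = 0
  · rw [ha] at hb this
    apply hb
    linear_combination -this
  · apply hl2
    rw [eq_div_iff ha]
    linear_combination -this

theorem vW_cont (s : ℤ) (lam x₁ x₂ x₃ : ℂ) (k : ℕ) (hl : lam + k ≠ 0)
    (h2 : ∀ j < (-((k : ℤ) + s - 1)).toNat, vq lam x₁ x₂ x₃ k (-j) ≠ 0) :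
    ContinuousAt (fun l => vW s l x₁ x₂ x₃ k) lam := by
  unfold vW
  split_ifs with h
  · exact tendsto_finsetProd _ fun j _ => vq_cont _ _ _ _ _ _ hl
  · refine ContinuousAt.inv₀ (tendsto_finsetProd _ fun j _ => vq_cont _ _ _ _ _ _ hl) ?_
    exact prod_ne_zero_iff.2 fun j hj => h2 j (mem_range.1 hj)

theorem vtau_cont (s : ℤ) (lam x₁ x₂ x₃ : ℂ) (n k : ℕ) (hl : lam + k ≠ 0)
    (h1 : ∀ j < ((k : ℤ) + s).toNat, vq lam x₁ x₂ x₃ k (n + 1 + j) ≠ 0) :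
    ContinuousAt (fun l => vtau s l x₁ x₂ x₃ n k) lam := by
  unfold vtau
  split_ifs with h
  · refine ContinuousAt.inv₀ (tendsto_finsetProd _ fun j _ => vq_cont _ _ _ _ _ _ hl) ?_
    exact prod_ne_zero_iff.2 fun j hj => h1 j (mem_range.1 hj)
  · exact tendsto_finsetProd _ fun j _ => vq_cont _ _ _ _ _ _ hl

theorem vev_lam (lam : ℂ) : ∀ᶠ l : ℂ in 𝓝[≠] lam, ∀ j : ℕ, l + j ≠ 0 := by
  obtain ⟨M, hM⟩ := exists_nat_gt (‖lam‖ + 1)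
  have h1 : ∀ᶠ l in 𝓝[≠] lam, ∀ j ∈ range M, l ≠ -(j : ℂ) :=
    (Finset.eventually_all _).2 fun j _ => vev_ne lam _
  have h2 : ∀ᶠ l in 𝓝[≠] lam, ‖l‖ < ‖lam‖ + 1 :=
    ((continuous_norm.tendsto lam).eventually (gt_mem_nhds (by linarith))).filter_mono nhdsWithin_le_nhds
  filter_upwards [h1, h2] with l h1 h2 j hj
  have hlj : l = -(j : ℂ) := by linear_combination hj
  by_cases hjM : j < M
  · exact h1 j (mem_range.2 hjM) hlj
  · rw [hlj] at h2
    simp at h2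
    have : (M : ℝ) ≤ j := by exact_mod_cast not_lt.1 hjM
    linarith

theorem vfinite (s : ℤ) (lam x₁ x₂ x₃ : ℂ) (hx : x₁ + x₂ + x₃ = (s : ℂ)) (n : ℕ)
    (h1 : ∀ j : ℕ, x₁ + j ≠ 0) (h2 : ∀ j : ℕ, x₂ + j ≠ 0) (h3 : ∀ j : ℕ, x₃ + j ≠ 0)
    (hl : ∀ j : ℕ, lam + j ≠ 0)
    (hq1 : ∀ k ≤ n, ∀ j < ((k : ℤ) + s).toNat, vq lam x₁ x₂ x₃ k (n + 1 + j) ≠ 0)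
    (hq2 : ∀ k ≤ n, ∀ j < (-((k : ℤ) + s - 1)).toNat, vq lam x₁ x₂ x₃ k (-j) ≠ 0) :
    vR x₁ x₂ x₃ n = ∑ k ∈ range (n + 1),
      ((-1) ^ k * vW s lam x₁ x₂ x₃ k / (k.factorial : ℂ) ^ 2
        * (1 / (x₁ + k) + 1 / (x₂ + k) + 1 / (x₃ + k) - 1 / (lam + k)))
      * ((n + k).factorial / (n - k).factorial * vtau s lam x₁ x₂ x₃ n k) := by
  have hc : ContinuousAt (fun lam => ∑ k ∈ range (n + 1),
      ((-1) ^ k * vW s lam x₁ x₂ x₃ k / (k.factorial : ℂ) ^ 2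
        * (1 / (x₁ + k) + 1 / (x₂ + k) + 1 / (x₃ + k) - 1 / (lam + k)))
      * ((n + k).factorial / (n - k).factorial * vtau s lam x₁ x₂ x₃ n k)) lam := by
    refine tendsto_finsetSum _ fun k hk => ?_
    have hk' : k ≤ n := by simpa [Nat.lt_succ_iff] using hk
    refine ContinuousAt.mul (ContinuousAt.mul ?_ ?_) ?_
    · exact ((vW_cont s lam x₁ x₂ x₃ k (hl k) (hq2 k hk')).const_mul _).div_const _
    · have := hl k
      fun_prop (disch := assumption)
    · exact (vtau_cont s lam x₁ x₂ x₃ n k (hl k) (hq1 k hk')).const_mul _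
  have hc' := hc.tendsto.mono_left (nhdsWithin_le_nhds (s := {lam}ᶜ))
  refine tendsto_nhds_unique (tendsto_const_nhds.congr' ?_) hc'
  have e1 : ∀ᶠ l in 𝓝[≠] lam, ∀ k ∈ range (n + 1), ∀ j ∈ range (n + 1), vq l x₁ x₂ x₃ k (-j) ≠ 0 :=
    (Finset.eventually_all _).2 fun k _ => (Finset.eventually_all _).2 fun j _ =>
      vq_ev lam x₁ x₂ x₃ k j (h1 k) (h2 k) (h3 k)
  have e2 : ∀ᶠ l in 𝓝[≠] lam, ∀ k ∈ range (n + 1), ∀ j ∈ range ((k : ℤ) + s).toNat, vq l x₁ x₂ x₃ k (n + 1 + j) ≠ 0 :=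
    (Finset.eventually_all _).2 fun k hk => (Finset.eventually_all _).2 fun j hj =>
      ((vq_cont _ _ _ _ _ _ (hl k)).eventually_ne (hq1 k (by have := mem_range.1 hk; omega) j (mem_range.1 hj))).filter_mono nhdsWithin_le_nhds
  have e3 : ∀ᶠ l in 𝓝[≠] lam, ∀ k ∈ range (n + 1), ∀ j ∈ range (-((k : ℤ) + s - 1)).toNat, vq l x₁ x₂ x₃ k (-j) ≠ 0 :=
    (Finset.eventually_all _).2 fun k hk => (Finset.eventually_all _).2 fun j hj =>
      ((vq_cont _ _ _ _ _ _ (hl k)).eventually_ne (hq2 k (by have := mem_range.1 hk; omega) j (mem_range.1 hj))).filter_mono nhdsWithin_le_nhds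
  filter_upwards [e1, e2, e3, vev_lam lam] with l e1 e2 e3 e4
  refine vgeneric s l x₁ x₂ x₃ hx n h1 h2 h3 e4 ?_ ?_ ?_
  · exact fun k hk j hj => e1 k (by simp; omega) j (by simp; omega)
  · exact fun k hk j hj => e2 k (by simp; omega) j (by simpa using hj)
  · exact fun k hk j hj => e3 k (by simp; omega) j (mem_range.2 hj)

/-- Gamma limit -/
theorem vGamma (s : ℤ) (x₁ x₂ x₃ : ℂ) (hx : x₁ + x₂ + x₃ = (s : ℂ))
    (g1 : ∀ m : ℕ, 1 - x₁ ≠ -(m : ℂ)) (g2 : ∀ m : ℕ, 1 - x₂ ≠ -(m : ℂ)) (g3 : ∀ m : ℕ, 1 - x₃ ≠ -(m : ℂ)) :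
    Tendsto (fun n : ℕ => (n : ℂ) ^ (2 * s) * vR x₁ x₂ x₃ n) atTop
      (𝓝 (Complex.Gamma x₁ * Complex.Gamma x₂ * Complex.Gamma x₃
            / (Complex.Gamma (1 - x₁) * Complex.Gamma (1 - x₂)
              * Complex.Gamma (1 - x₃)))) := by
  have hlim := (((GammaSeq_tendsto_Gamma x₁).mul (GammaSeq_tendsto_Gamma x₂)).mul (GammaSeq_tendsto_Gamma x₃)).div
    (((GammaSeq_tendsto_Gamma (1 - x₁)).mul (GammaSeq_tendsto_Gamma (1 - x₂))).mul (GammaSeq_tendsto_Gamma (1 - x₃)))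
    (mul_ne_zero (mul_ne_zero (Gamma_ne_zero g1) (Gamma_ne_zero g2)) (Gamma_ne_zero g3))
  have hone : ∀ x : ℂ, Tendsto (fun n : ℕ => (n : ℂ) / (n + 1 - x)) atTop (𝓝 1) := by
    intro x
    have := tendsto_natCast_div_add_atTop (𝕜 := ℂ) (1 - x)
    refine this.congr fun n => ?_
    rw [add_sub_assoc]
  have h := hlim.mul (((hone x₁).mul (hone x₂)).mul (hone x₃))
  rw [mul_one, mul_one, mul_one] at h
  refine h.congr' ?_
  filter_upwards [eventually_ne_atTop 0] with n hn
  have hn' : (n : ℂ) ≠ 0 := by exact_mod_cast hn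
  have hp : ∀ x : ℂ, (∀ m : ℕ, 1 - x ≠ -(m : ℂ)) → ∀ m : ℕ, (m : ℂ) + 1 - x ≠ 0 := by
    intro x hx m h0
    exact hx m (by linear_combination h0)
  have hfac : ((n.factorial : ℕ) : ℂ) ≠ 0 := by exact_mod_cast n.factorial_ne_zero
  have key : ∀ x : ℂ, (∀ m : ℕ, 1 - x ≠ -(m : ℂ)) →
      GammaSeq x n / GammaSeq (1 - x) n * (n / (n + 1 - x))
        = (n : ℂ) ^ (2 * x) * ((∏ j ∈ range n, ((j : ℂ) + 1 - x)) / ∏ j ∈ range (n + 1), (x + j)) := by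
    intro x hx
    have hx' := hp x hx
    unfold GammaSeq
    rw [prod_range_succ (fun j : ℕ => 1 - x + (j : ℂ))]
    have e1 : ∏ j ∈ range n, (1 - x + (j : ℂ)) = ∏ j ∈ range n, ((j : ℂ) + 1 - x) :=
      prod_congr rfl fun j _ => by ring
    have e2 : 1 - x + (n : ℂ) = n + 1 - x := by ring
    have e3 : (n : ℂ) ^ (1 - x) = n / (n : ℂ) ^ x := by rw [cpow_sub _ _ hn', cpow_one]
    have e4 : (n : ℂ) ^ (2 * x) = (n : ℂ) ^ x * (n : ℂ) ^ x := by rw [← cpow_add _ _ hn']; ring_nf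
    have e5 : (n : ℂ) ^ x ≠ 0 := by simp [cpow_eq_zero_iff, hn']
    rw [e1, e2, e3, e4]
    have := hx' n
    have e6 : ∏ j ∈ range n, ((j : ℂ) + 1 - x) ≠ 0 := prod_ne_zero_iff.2 fun j _ => hx' j
    generalize ∏ j ∈ range n, ((j : ℂ) + 1 - x) = A at *
    generalize ∏ j ∈ range (n + 1), (x + (j : ℂ)) = B at *
    generalize (n : ℂ) ^ x = D at *
    by_cases hB : B = 0
    · simp [hB]
    field_simp
  have k1 := key x₁ g1
  have k2 := key x₂ g2
  have k3 := key x₃ g3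
  have hpow : (n : ℂ) ^ (2 * s) = (n : ℂ) ^ (2 * x₁) * (n : ℂ) ^ (2 * x₂) * (n : ℂ) ^ (2 * x₃) := by
    rw [← cpow_add _ _ hn', ← cpow_add _ _ hn', ← cpow_intCast]
    congr 1
    push_cast
    rw [← hx]; ring
  rw [hpow, vR, prod_mul_distrib, prod_mul_distrib, prod_mul_distrib, prod_mul_distrib]
  calc _ = (GammaSeq x₁ n / GammaSeq (1 - x₁) n * (n / (n + 1 - x₁))) * (GammaSeq x₂ n / GammaSeq (1 - x₂) n * (n / (n + 1 - x₂))) * (GammaSeq x₃ n / GammaSeq (1 - x₃) n * (n / (n + 1 - x₃))) := by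
        simp only [Pi.div_apply, div_eq_mul_inv, mul_inv]; ring
    _ = _ := by
        rw [k1, k2, k3]
        simp only [Pi.div_apply, div_eq_mul_inv, mul_inv]; ring


theorem vtannery (F : ℕ → ℕ → ℂ) (T : ℕ → ℂ) (A : ℂ) (δ C : ℝ) (K n1 : ℕ) (hδ : 0 < δ) (hδ1 : δ ≤ 1)
    (hC : 0 ≤ C) (hK : 1 ≤ K)
    (hlim : ∀ k, Tendsto (fun n => F n k) atTop (𝓝 (T k)))
    (hb : ∀ n ≥ n1, ∀ k, K ≤ k → k ≤ n →
      ‖F n k‖ ≤ C * (k : ℝ) ^ (-1 - 2 * δ) * ((n : ℝ) / (n - k + 1)) ^ (1 - δ))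
    (hF : Tendsto (fun n => ∑ k ∈ range (n + 1), F n k) atTop (𝓝 A)) :
    Tendsto (fun N => ∑ k ∈ range N, T k) atTop (𝓝 A) := by
  set bound : ℕ → ℝ := fun k => 2 * C * (k : ℝ) ^ (-1 - 2 * δ) + if k < K then ‖T k‖ + 1 else 0 with hbd
  have hsum : Summable bound := by
    refine Summable.add ?_ ?_
    · exact (Real.summable_nat_rpow.2 (by linarith)).mul_left _
    · refine summable_of_ne_finset_zero (s := range K) fun k hk => ?_
      rw [if_neg (by simpa using hk)]
  set G : ℕ → ℕ → ℂ := fun n k => if 2 * k ≤ n then F n k else 0 with hG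
  have hGlim : ∀ k, Tendsto (fun n => G n k) atTop (𝓝 (T k)) := by
    intro k
    refine (hlim k).congr' ?_
    filter_upwards [eventually_ge_atTop (2 * k)] with n hn
    simp [hG, hn]
  have hsmall : ∀ᶠ n in atTop, ∀ k ∈ range K, ‖G n k‖ ≤ ‖T k‖ + 1 :=
    (Finset.eventually_all _).2 fun k _ => by
      have := (hGlim k).norm.eventually (gt_mem_nhds (show ‖T k‖ < ‖T k‖ + 1 by linarith))
      filter_upwards [this] with n hn using hn.le
  have hbound : ∀ᶠ n in atTop, ∀ k, ‖G n k‖ ≤ bound k := by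
    filter_upwards [hsmall, eventually_ge_atTop n1] with n h1 hn k
    have hpos : 0 ≤ 2 * C * (k : ℝ) ^ (-1 - 2 * δ) := by positivity
    by_cases hk : k < K
    · simp only [hbd, if_pos hk]
      linarith [h1 k (mem_range.2 hk)]
    · simp only [hbd, if_neg hk, add_zero]
      simp only [hG]
      split_ifs with h2
      · refine (hb n hn k (by omega) (by omega)).trans ?_
        have h2' : 2 * (k : ℝ) ≤ n := by exact_mod_cast h2
        have hk1 : (0 : ℝ) ≤ k := by positivity
        have : ((n : ℝ) / (n - k + 1)) ^ (1 - δ) ≤ 2 := by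
          calc ((n : ℝ) / (n - k + 1)) ^ (1 - δ) ≤ 2 ^ (1 - δ) := by
                refine Real.rpow_le_rpow ?_ ?_ (by linarith)
                · apply div_nonneg <;> linarith
                · rw [div_le_iff₀] <;> linarith
            _ ≤ 2 ^ (1 : ℝ) := Real.rpow_le_rpow_of_exponent_le (by norm_num) (by linarith)
            _ = 2 := by simp
        calc _ ≤ C * (k : ℝ) ^ (-1 - 2 * δ) * 2 := by gcongr
          _ = _ := by ring
      · simpa using hpos
  have hmain := tendsto_tsum_of_dominated_convergence hsum hGlim hbound
  have hTb : ∀ k, ‖T k‖ ≤ bound k := by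
    intro k
    refine le_of_tendsto (hGlim k).norm ?_
    filter_upwards [hbound] with n hn using hn k
  have hTs : Summable T := Summable.of_norm_bounded hsum hTb
  have hT := hTs.hasSum.tendsto_sum_nat
  suffices h : (∑' k, T k) = A by rwa [h] at hT
  -- remaining part
  have hGsum : ∀ n, ∑' k, G n k = ∑ k ∈ range (n + 1), G n k := by
    intro n
    refine tsum_eq_sum fun k hk => ?_
    simp only [hG]
    rw [if_neg]
    simp at hk; omega
  simp_rw [hGsum] at hmain
  set Z : ℝ := ∑' j : ℕ, (j : ℝ) ^ (-1 - δ) with hZ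
  have hZs : Summable (fun j : ℕ => (j : ℝ) ^ (-1 - δ)) := Real.summable_nat_rpow.2 (by linarith)
  have hdiff : Tendsto (fun n => ∑ k ∈ range (n + 1), F n k - ∑ k ∈ range (n + 1), G n k) atTop (𝓝 0) := by
    have hz : Tendsto (fun n : ℕ => 8 * C * (n : ℝ) ^ (-δ) * Z) atTop (𝓝 0) := by
      have := (tendsto_rpow_neg_atTop hδ).comp (tendsto_natCast_atTop_atTop (R := ℝ))
      have := (this.const_mul (8 * C)).mul_const Z
      simpa using this
    refine squeeze_zero_norm' ?_ hz
    filter_upwards [eventually_ge_atTop n1, eventually_ge_atTop (2 * K), eventually_ge_atTop 1] with n hn hnK hn1'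
    rw [← sum_sub_distrib]
    have hn0 : (0 : ℝ) < n := by exact_mod_cast hn1'
    calc ‖∑ k ∈ range (n + 1), (F n k - G n k)‖ ≤ ∑ k ∈ range (n + 1), ‖F n k - G n k‖ := norm_sum_le _ _
      _ ≤ ∑ k ∈ range (n + 1), 8 * C * (n : ℝ) ^ (-δ) * ((n + 1 - k : ℕ) : ℝ) ^ (-1 - δ) := by
          refine sum_le_sum fun k hk => ?_
          have hk' : k ≤ n := by simpa [Nat.lt_succ_iff] using hk
          simp only [hG]
          split_ifs with h2
          · simp; positivity
          · rw [sub_zero]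
            refine (hb n hn k (by omega) hk').trans ?_
            have hjc : ((n + 1 - k : ℕ) : ℝ) = n - k + 1 := by
              rw [Nat.cast_sub (by omega)]; push_cast; ring
            set j : ℝ := ((n + 1 - k : ℕ) : ℝ) with hj
            rw [← hjc]
            have hj1 : 1 ≤ j := by
              rw [hj]; exact_mod_cast (show 1 ≤ n + 1 - k by omega)
            have hjn : j ≤ n := by
              rw [hj]; exact_mod_cast (show n + 1 - k ≤ n by omega)
            have hkn : (n : ℝ) / 2 ≤ k := by
              have : (n : ℝ) < 2 * k := by exact_mod_cast not_le.1 h2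
              linarith
            have hk0 : (0 : ℝ) < k := by linarith
            have e1 : (k : ℝ) ^ (-1 - 2 * δ) ≤ 8 * (n : ℝ) ^ (-1 - 2 * δ) := by
              calc (k : ℝ) ^ (-1 - 2 * δ) ≤ ((n : ℝ) / 2) ^ (-1 - 2 * δ) :=
                    Real.rpow_le_rpow_of_nonpos (by positivity) hkn (by linarith)
                _ = (n : ℝ) ^ (-1 - 2 * δ) * (2 : ℝ) ^ (1 + 2 * δ) := by
                    rw [Real.div_rpow hn0.le (by norm_num), div_eq_mul_inv, ← Real.rpow_neg (by norm_num)]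
                    congr 2; ring
                _ ≤ (n : ℝ) ^ (-1 - 2 * δ) * (2 : ℝ) ^ (3 : ℝ) := by
                    gcongr
                    · norm_num
                    · linarith
                _ = _ := by norm_num; ring
            have e2 : ((n : ℝ) / j) ^ (1 - δ) = (n : ℝ) ^ (1 - δ) * (j ^ (-1 - δ) * j ^ (2 * δ)) := by
              rw [Real.div_rpow hn0.le (by linarith), ← Real.rpow_add (by linarith), div_eq_mul_inv,
                ← Real.rpow_neg (by linarith)]
              congr 2; ring
            have e3 : j ^ (2 * δ) ≤ (n : ℝ) ^ (2 * δ) := Real.rpow_le_rpow (by linarith) hjn (by linarith)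
            have e4 : (n : ℝ) ^ (-1 - 2 * δ) * (n : ℝ) ^ (1 - δ) * (n : ℝ) ^ (2 * δ) = (n : ℝ) ^ (-δ) := by
              rw [← Real.rpow_add hn0, ← Real.rpow_add hn0]; congr 1; ring
            have hjp : 0 ≤ j ^ (-1 - δ) := Real.rpow_nonneg (by linarith) _
            calc _ ≤ C * (8 * (n : ℝ) ^ (-1 - 2 * δ)) * ((n : ℝ) ^ (1 - δ) * (j ^ (-1 - δ) * (n : ℝ) ^ (2 * δ))) := by
                  rw [e2]
                  gcongr
              _ = 8 * C * ((n : ℝ) ^ (-1 - 2 * δ) * (n : ℝ) ^ (1 - δ) * (n : ℝ) ^ (2 * δ)) * j ^ (-1 - δ) := by ring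
              _ = _ := by rw [e4]
      _ = 8 * C * (n : ℝ) ^ (-δ) * ∑ k ∈ range (n + 1), ((k + 1 : ℕ) : ℝ) ^ (-1 - δ) := by
          rw [← mul_sum]
          congr 1
          rw [← sum_range_reflect]
          refine sum_congr rfl fun k hk => ?_
          have := mem_range.1 hk
          congr 2; omega
      _ ≤ 8 * C * (n : ℝ) ^ (-δ) * Z := by
          gcongr
          have hle := hZs.sum_le_tsum (range (n + 2)) (fun i _ => by positivity)
          rw [sum_range_succ'] at hle
          have : 0 ≤ ((0 : ℕ) : ℝ) ^ (-1 - δ) := by positivity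
          linarith
  have h3 := hF.sub hmain
  have := tendsto_nhds_unique h3 hdiff
  exact (sub_eq_zero.1 this).symm

theorem vratio (a : ℂ) : Tendsto (fun n : ℕ => ((n : ℂ) + a) / n) atTop (𝓝 1) := by
  have h : Tendsto (fun n : ℕ => 1 + a * (n : ℂ)⁻¹) atTop (𝓝 (1 + a * 0)) :=
    tendsto_const_nhds.add (tendsto_const_nhds.mul (tendsto_inv_atTop_nhds_zero_nat (𝕜 := ℂ)))
  rw [mul_zero, add_zero] at h
  refine h.congr' ?_
  filter_upwards [eventually_ne_atTop 0] with n hn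
  have hn' : (n : ℂ) ≠ 0 := by exact_mod_cast hn
  field_simp

theorem vquad (a b c : ℂ) : Tendsto (fun n : ℕ => (((n : ℂ) + a) * (n + b) - c) / (n : ℂ) ^ 2) atTop (𝓝 1) := by
  have h0 := (tendsto_inv_atTop_nhds_zero_nat (𝕜 := ℂ))
  have h := ((vratio a).mul (vratio b)).sub (((h0.mul h0).const_mul c))
  simp only [mul_zero, mul_one, sub_zero] at h
  refine h.congr' ?_
  filter_upwards [eventually_ne_atTop 0] with n hn
  have hn' : (n : ℂ) ≠ 0 := by exact_mod_cast hn
  field_simp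

theorem vprodlim (m p : ℕ) (f : ℕ → ℕ → ℂ) (h : ∀ i, Tendsto (fun n : ℕ => f i n / (n : ℂ) ^ p) atTop (𝓝 1)) :
    Tendsto (fun n : ℕ => (∏ i ∈ range m, f i n) / (n : ℂ) ^ (p * m)) atTop (𝓝 1) := by
  have := tendsto_finsetProd (range m) fun i _ => h i
  simp only [prod_const_one] at this
  refine this.congr fun n => ?_
  rw [prod_div_distrib, prod_const, card_range, pow_mul]

theorem vpoint (s : ℤ) (lam x₁ x₂ x₃ : ℂ) (k : ℕ) :
    Tendsto (fun n : ℕ => (n : ℂ) ^ (2 * s) * ((n + k).factorial / (n - k).factorial * vtau s lam x₁ x₂ x₃ n k))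
      atTop (𝓝 1) := by
  have hA := vprodlim (2 * k) 1 (fun i n => (n : ℂ) + (i + 1 - k)) (fun i => by simpa using vratio _)
  have hfac : ∀ n ≥ k, (((n + k).factorial : ℕ) : ℂ) / (n - k).factorial = ∏ i ∈ range (2 * k), ((n : ℂ) + (i + 1 - k)) := by
    intro n hn
    have := vfact1 (2 * k) (n - k)
    rw [show 2 * k + (n - k) = n + k by omega] at this
    rw [← this]
    refine prod_congr rfl fun i _ => ?_
    rw [Nat.cast_sub hn]; ring
  unfold vtau
  split_ifs with h
  · obtain ⟨m, hm⟩ := Int.eq_ofNat_of_zero_le (show 0 ≤ (k : ℤ) + s by omega)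
    have e2 : ((k : ℤ) + s).toNat = m := by omega
    have hs : s = m - k := by omega
    rw [e2]
    have hB := vprodlim m 2 (fun i n => vq lam x₁ x₂ x₃ k (n + 1 + i)) (fun i => by
      refine (vquad (1 + i - lam) (1 + i - (x₁ + x₂ + x₃) - k + lam) ((x₁ - lam) * (x₂ - lam) * (x₃ - lam) / (lam + k))).congr fun n => ?_
      unfold vq; ring)
    have hAB := hA.div hB one_ne_zero
    rw [div_one] at hAB
    refine hAB.congr' ?_
    filter_upwards [eventually_ge_atTop k, eventually_ne_atTop 0] with n hn hn0
    have hn' : (n : ℂ) ≠ 0 := by exact_mod_cast hn0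
    rw [hfac n hn]
    have : (n : ℂ) ^ (2 * s) = (n : ℂ) ^ (2 * m) / (n : ℂ) ^ (1 * (2 * k)) := by
      rw [← zpow_natCast, ← zpow_natCast, ← zpow_sub₀ hn', hs]; congr 1; push_cast; ring
    rw [this, Pi.div_apply, div_div_div_eq, div_mul_eq_mul_div, ← div_eq_mul_inv, mul_div_assoc', div_div]
    ring
  · obtain ⟨m, hm⟩ := Int.eq_ofNat_of_zero_le (show 0 ≤ -((k : ℤ) + s) by omega)
    have e2 : (-((k : ℤ) + s)).toNat = m := by omega
    have hs : s = - m - k := by omega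
    rw [e2]
    have hB := vprodlim m 2 (fun i n => vq lam x₁ x₂ x₃ k (-(n + 1 + i))) (fun i => by
      refine (vquad (1 + i + lam) (1 + i + (x₁ + x₂ + x₃) + k - lam) ((x₁ - lam) * (x₂ - lam) * (x₃ - lam) / (lam + k))).congr fun n => ?_
      unfold vq; ring)
    have hAB := hA.mul hB
    rw [mul_one] at hAB
    refine hAB.congr' ?_
    filter_upwards [eventually_ge_atTop k, eventually_ne_atTop 0] with n hn hn0
    have hn' : (n : ℂ) ≠ 0 := by exact_mod_cast hn0
    rw [hfac n hn]
    have : (n : ℂ) ^ (2 * s) = ((n : ℂ) ^ (2 * m) * (n : ℂ) ^ (1 * (2 * k)))⁻¹ := by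
      rw [← zpow_natCast, ← zpow_natCast, ← zpow_add₀ hn', ← zpow_neg, hs]; congr 1; push_cast; ring
    rw [this, mul_inv, div_mul_div_comm, div_eq_mul_inv, mul_inv]
    ring


theorem vup (w : ℂ) : ‖1 + w‖ ≤ Real.exp (w.re + ‖w‖ ^ 2 / 2) := by
  have h : ‖1 + w‖ ^ 2 ≤ (Real.exp (w.re + ‖w‖ ^ 2 / 2)) ^ 2 := by
    rw [← Real.exp_nat_mul]
    have e : ‖1 + w‖ ^ 2 = 1 + 2 * w.re + ‖w‖ ^ 2 := by
      rw [Complex.sq_norm, Complex.sq_norm, Complex.normSq_apply, Complex.normSq_apply]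
      simp; ring
    rw [e]
    have := Real.add_one_le_exp (2 * w.re + ‖w‖ ^ 2)
    refine le_trans (by linarith) (this.trans (le_of_eq ?_))
    congr 1; push_cast; ring
  exact le_of_sq_le_sq h (Real.exp_pos _).le

theorem vexp2 (x : ℝ) (h0 : 0 ≤ x) (h1 : x ≤ 1 / 2) : Real.exp (-2 * x) ≤ 1 - x := by
  have h := Real.add_one_le_exp (2 * x)
  have h2 : Real.exp (-2 * x) = (Real.exp (2 * x))⁻¹ := by rw [← Real.exp_neg]; ring_nf
  rw [h2, inv_le_comm₀ (Real.exp_pos _) (by linarith)]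
  refine le_trans ?_ h
  rw [inv_le_iff_one_le_mul₀ (by linarith)]
  nlinarith

theorem vlow (w : ℂ) (hw : ‖w‖ ≤ 1 / 2) : Real.exp (w.re - 5 / 2 * ‖w‖ ^ 2) ≤ ‖1 + w‖ := by
  have h1 := vup (-w)
  have hn : 0 ≤ ‖w‖ := norm_nonneg _
  have h2 : 1 - ‖w‖ ^ 2 ≤ ‖1 + w‖ * ‖1 + -w‖ := by
    rw [← norm_mul]
    have : (1 + w) * (1 + -w) = 1 - w ^ 2 := by ring
    rw [this]
    have := norm_sub_norm_le 1 (w ^ 2)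
    rw [norm_one, norm_pow] at this
    exact this
  have h3 := vexp2 (‖w‖ ^ 2) (by positivity) (by nlinarith)
  rw [norm_neg, neg_re] at h1
  have h4 : Real.exp (-2 * ‖w‖ ^ 2) ≤ ‖1 + w‖ * Real.exp (-w.re + ‖w‖ ^ 2 / 2) :=
    h3.trans (h2.trans (by gcongr))
  rw [← div_le_iff₀ (Real.exp_pos _), ← Real.exp_sub] at h4
  refine le_trans (le_of_eq ?_) h4
  congr 1; ring

theorem vlow' (z : ℂ) (hz : -1 < z.re) : ∃ C : ℝ, 0 ≤ C ∧ ∀ j : ℕ, 1 ≤ j →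
    (j : ℝ) * Real.exp (z.re / j - C / (j : ℝ) ^ 2) ≤ ‖(j : ℂ) + z‖ := by
  set θ : ℝ := min 1 (1 + z.re) with hθ
  have hθ0 : 0 < θ := lt_min one_pos (by linarith)
  have hlog : Real.log θ ≤ 0 := Real.log_nonpos hθ0.le (min_le_left _ _)
  have hre : z.re ≤ ‖z‖ := Complex.re_le_norm z
  have hz0 : 0 ≤ ‖z‖ := norm_nonneg z
  refine ⟨5 / 2 * ‖z‖ ^ 2 + 4 * ‖z‖ ^ 2 * (-Real.log θ), by
    have : 0 ≤ 4 * ‖z‖ ^ 2 * (-Real.log θ) := mul_nonneg (by positivity) (by linarith)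
    positivity, ?_⟩
  intro j hj
  have hj1 : (1 : ℝ) ≤ j := by exact_mod_cast hj
  have hj0 : (0 : ℝ) < j := by linarith
  by_cases hc : 2 * ‖z‖ ≤ j
  · have hjc : (j : ℂ) ≠ 0 := by exact_mod_cast hj0.ne'
    have e : (j : ℂ) + z = j * (1 + z / j) := by field_simp
    rw [e, norm_mul, Complex.norm_natCast]
    refine mul_le_mul_of_nonneg_left ?_ hj0.le
    have hnw : ‖z / j‖ = ‖z‖ / j := by rw [norm_div, Complex.norm_natCast]
    have := vlow (z / j) (by rw [hnw, div_le_iff₀ hj0]; linarith)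
    refine le_trans (Real.exp_le_exp.2 ?_) this
    rw [hnw, Complex.div_natCast_re, div_pow]
    have h0 : 0 ≤ 4 * ‖z‖ ^ 2 * (-Real.log θ) / (j : ℝ) ^ 2 :=
      div_nonneg (mul_nonneg (by positivity) (by linarith)) (by positivity)
    rw [add_div, mul_div_assoc]
    linarith
  · have hc' : (j : ℝ) < 2 * ‖z‖ := not_le.1 hc
    have h1 : θ * j ≤ ‖(j : ℂ) + z‖ := by
      refine le_trans ?_ (Complex.re_le_norm _)
      simp
      have a1 : θ ≤ 1 := min_le_left _ _
      have a2 : θ ≤ 1 + z.re := min_le_right _ _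
      nlinarith
    refine le_trans ?_ h1
    rw [mul_comm]
    refine mul_le_mul_of_nonneg_right ?_ hj0.le
    rw [← Real.le_log_iff_exp_le hθ0]
    have b1 : z.re / j ≤ 5 / 2 * ‖z‖ ^ 2 / (j : ℝ) ^ 2 := by
      rw [div_le_div_iff₀ hj0 (by positivity)]
      have : z.re * j ≤ 5 / 2 * ‖z‖ ^ 2 := by nlinarith
      nlinarith
    have b2 : -Real.log θ ≤ 4 * ‖z‖ ^ 2 * (-Real.log θ) / (j : ℝ) ^ 2 := by
      rw [le_div_iff₀ (by positivity)]
      have : (j : ℝ) ^ 2 ≤ 4 * ‖z‖ ^ 2 := by nlinarith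
      nlinarith
    rw [add_div]
    linarith

theorem vc_bdd (lam c : ℂ) : ∃ C : ℝ, 0 ≤ C ∧ ∀ k : ℕ, ‖c / (lam + k)‖ ≤ C := by
  have : Tendsto (fun k : ℕ => ‖c / (lam + k)‖) atTop (𝓝 0) := by
    have h : Tendsto (fun n : ℕ => (n : ℂ)⁻¹ * ((n : ℂ) / (n + lam))) atTop (𝓝 (0 * 1)) :=
      (tendsto_inv_atTop_nhds_zero_nat (𝕜 := ℂ)).mul (tendsto_natCast_div_add_atTop lam)
    have h2 := (h.const_mul c).norm
    simp only [zero_mul, mul_zero, norm_zero] at h2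
    refine h2.congr' ?_
    filter_upwards [eventually_ne_atTop 0] with n hn
    have hn' : (n : ℂ) ≠ 0 := by exact_mod_cast hn
    rw [add_comm lam]
    congr 1
    rw [← mul_div_assoc, inv_mul_cancel₀ hn', div_eq_mul_inv, div_eq_mul_inv, one_mul]
  obtain ⟨C, hC⟩ := this.bddAbove_range
  exact ⟨C, (norm_nonneg _).trans (hC ⟨0, rfl⟩), fun k => hC ⟨k, rfl⟩⟩

theorem vsq_bdd : ∃ Z : ℝ, 0 ≤ Z ∧ ∀ a m : ℕ, ∑ i ∈ range m, 1 / ((a + 1 + i : ℕ) : ℝ) ^ 2 ≤ Z := by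
  have hs : Summable (fun n : ℕ => 1 / (n : ℝ) ^ 2) := Real.summable_one_div_nat_pow.2 (by norm_num)
  refine ⟨∑' n : ℕ, 1 / (n : ℝ) ^ 2, tsum_nonneg fun i => by positivity, fun a m => ?_⟩
  refine le_trans ?_ (hs.sum_le_tsum (range (a + 1 + m)) fun i _ => by positivity)
  rw [sum_range_add]
  have : 0 ≤ ∑ x ∈ range (a + 1), 1 / (x : ℝ) ^ 2 := sum_nonneg fun i _ => by positivity
  linarith

theorem vharm (a m : ℕ) : ∑ i ∈ range m, 1 / ((a + 1 + i : ℕ) : ℝ) = (harmonic (a + m) : ℝ) - harmonic a := by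
  simp only [harmonic]
  push_cast
  rw [sum_range_add]
  rw [add_sub_cancel_left]
  refine sum_congr rfl fun i _ => ?_
  push_cast
  rw [one_div]; congr 1; ring

/-- Factorial ratio asymptotics. -/
theorem vfaclim (e : ℤ) : Tendsto (fun n : ℕ => (((n + e).toNat).factorial : ℝ) / (n.factorial * (n : ℝ) ^ e)) atTop (𝓝 1) := by
  suffices h : Tendsto (fun n : ℕ => (((n + e).toNat).factorial : ℂ) / (n.factorial * (n : ℂ) ^ e)) atTop (𝓝 1) by
    have := (Complex.continuous_re.tendsto 1).comp h
    rw [Complex.one_re] at this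
    refine this.congr fun n => ?_
    rw [Function.comp_apply, ← Complex.ofReal_re ((((n + e).toNat).factorial : ℝ) / (n.factorial * (n : ℝ) ^ e))]
    push_cast; rfl
  rcases le_total 0 e with he | he
  · obtain ⟨p, rfl⟩ := Int.eq_ofNat_of_zero_le he
    have hA := vprodlim p 1 (fun i n => (n : ℂ) + (i + 1)) (fun i => by simpa using vratio _)
    refine hA.congr fun n => ?_
    have := vfact1 p n
    have e1 : ((n : ℤ) + p).toNat = p + n := by omega
    have e2 : ∏ i ∈ range p, ((n : ℂ) + (i + 1)) = ∏ i ∈ range p, ((i : ℂ) + 1 + n) := prod_congr rfl fun i _ => by ring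
    rw [e1, e2, this, div_div, one_mul, zpow_natCast]
  · obtain ⟨p, hp⟩ := Int.eq_ofNat_of_zero_le (show 0 ≤ -e by omega)
    obtain rfl : e = -p := by omega
    have hA := vprodlim p 1 (fun i n => (n : ℂ) + (i + 1 - p)) (fun i => by simpa using vratio _)
    have hA' := hA.inv₀ one_ne_zero
    rw [inv_one] at hA'
    refine hA'.congr' ?_
    filter_upwards [eventually_ge_atTop p, eventually_ne_atTop 0] with n hn hn0
    have hn' : (n : ℂ) ≠ 0 := by exact_mod_cast hn0
    have := vfact1 p (n - p)
    have e1 : ((n : ℤ) + -p).toNat = n - p := by omega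
    have e2 : ∏ i ∈ range p, ((n : ℂ) + (i + 1 - p)) = ∏ i ∈ range p, ((i : ℂ) + 1 + (n - p : ℕ)) :=
      prod_congr rfl fun i _ => by rw [Nat.cast_sub hn]; ring
    rw [e1, e2, this, show p + (n - p) = n by omega, one_mul, zpow_neg, zpow_natCast, div_div, inv_div]
    rw [← div_eq_mul_inv, div_div_eq_mul_div]

theorem vfac_bd (e : ℤ) : ∃ N : ℕ, ∀ n ≥ N, (((n + e).toNat).factorial : ℝ) ≤ 2 * (n.factorial * (n : ℝ) ^ e)
    ∧ (n.factorial * (n : ℝ) ^ e) ≤ 2 * (((n + e).toNat).factorial : ℝ) := by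
  have h := vfaclim e
  have h1 := h.eventually (gt_mem_nhds (show (1 : ℝ) < 2 by norm_num))
  have h2 := h.eventually (lt_mem_nhds (show (1 / 2 : ℝ) < 1 by norm_num))
  obtain ⟨N, hN⟩ := eventually_atTop.1 ((h1.and h2).and (eventually_ge_atTop 1))
  refine ⟨N, fun n hn => ?_⟩
  obtain ⟨⟨a, b⟩, c⟩ := hN n hn
  have hn0 : (0 : ℝ) < n := by exact_mod_cast c
  have hp : 0 < (n.factorial * (n : ℝ) ^ e) := by positivity
  rw [div_lt_iff₀ hp] at a
  rw [lt_div_iff₀ hp] at b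
  constructor <;> linarith


theorem vtail_low (s : ℤ) (lam x₁ x₂ x₃ : ℂ) (hx : x₁ + x₂ + x₃ = (s : ℂ))
    (hre : 0 < (lam + 1 - (s : ℂ)).re) :
    ∃ C : ℝ, ∃ N : ℕ, 0 ≤ C ∧ 1 ≤ N ∧ ∀ n ≥ N, ∀ k ≤ n, ∀ i : ℕ,
      ((n + 1 + i : ℕ) : ℝ) * ((n - k + 1 + i : ℕ) : ℝ)
        * Real.exp ((lam - s).re / ((n - k + 1 + i : ℕ) : ℝ) - C / ((n - k + 1 + i : ℕ) : ℝ) ^ 2 - C / n)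
      ≤ ‖vq lam x₁ x₂ x₃ k (n + 1 + i)‖ := by
  obtain ⟨C1, hC1, hl⟩ := vlow' (lam - s) (by simp at hre ⊢; linarith)
  obtain ⟨C0, hC0, hc⟩ := vc_bdd lam ((x₁ - lam) * (x₂ - lam) * (x₃ - lam))
  set L := ‖lam‖ with hL
  have hL0 : 0 ≤ L := norm_nonneg _
  set θ : ℝ := Real.exp (-‖lam - s‖ - C1) with hθ
  have hθ0 : 0 < θ := Real.exp_pos _
  set D : ℝ := 2 * C0 / θ with hD
  have hD0 : 0 ≤ D := by positivity
  obtain ⟨N, hN⟩ := exists_nat_gt (max 1 (max (2 * L) (2 * D)))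
  have hN1 : (1 : ℝ) < N := (le_max_left _ _).trans_lt hN
  have hN2 : 2 * L < N := ((le_max_left _ _).trans (le_max_right _ _)).trans_lt hN
  have hN3 : 2 * D < N := ((le_max_right _ _).trans (le_max_right _ _)).trans_lt hN
  refine ⟨C1 + 2 * L + 2 * D, N, by positivity, by exact_mod_cast hN1.le, ?_⟩
  intro n hn k hk i
  have hnN : (N : ℝ) ≤ n := by exact_mod_cast hn
  have hn1 : (1 : ℝ) < n := by linarith
  have hn0 : (0 : ℝ) < n := by linarith
  set a : ℕ := n + 1 + i with ha
  set b : ℕ := n - k + 1 + i with hb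
  have hb1 : (1 : ℝ) ≤ b := by exact_mod_cast (show 1 ≤ b by omega)
  have hb0 : (0 : ℝ) < b := by linarith
  have han : (n : ℝ) ≤ a := by exact_mod_cast (show n ≤ a by omega)
  have hq : vq lam x₁ x₂ x₃ k (n + 1 + i) = (a - lam) * (b + (lam - s)) - (x₁ - lam) * (x₂ - lam) * (x₃ - lam) / (lam + k) := by
    unfold vq
    rw [hx, ha, hb]
    push_cast [Nat.cast_sub hk]
    ring
  have h1 : ‖(a : ℂ) - lam‖ * ‖(b : ℂ) + (lam - s)‖ - C0 ≤ ‖vq lam x₁ x₂ x₃ k (n + 1 + i)‖ := by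
    rw [hq, ← norm_mul]
    have := norm_sub_norm_le ((a - lam) * (b + (lam - s))) ((x₁ - lam) * (x₂ - lam) * (x₃ - lam) / (lam + k))
    linarith [hc k]
  refine le_trans ?_ h1
  have hb2 := hl b (by omega)
  have hbθ : θ ≤ ‖(b : ℂ) + (lam - s)‖ := by
    refine le_trans ?_ hb2
    have : θ ≤ Real.exp ((lam - s).re / b - C1 / (b : ℝ) ^ 2) := by
      apply Real.exp_le_exp.2
      have e1 : -‖lam - s‖ ≤ (lam - s).re / b := by
        rw [le_div_iff₀ hb0]
        have := Complex.abs_re_le_norm (lam - s)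
        have h2 := (abs_le.1 this).1
        nlinarith [norm_nonneg (lam - s)]
      have e2 : C1 / (b : ℝ) ^ 2 ≤ C1 := div_le_self hC1 (by nlinarith)
      linarith
    nlinarith
  have haL : (a : ℝ) * (1 - L / n) ≤ ‖(a : ℂ) - lam‖ := by
    have := norm_sub_norm_le (a : ℂ) lam
    rw [Complex.norm_natCast] at this
    refine le_trans ?_ this
    have : L ≤ a * (L / n) := by
      rw [mul_div_assoc', le_div_iff₀ hn0]
      nlinarith
    nlinarith
  have hLn : L / n ≤ 1 / 2 := by rw [div_le_iff₀ hn0]; linarith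
  have hDn : D / n ≤ 1 / 2 := by rw [div_le_iff₀ hn0]; linarith
  have hLe := vexp2 (L / n) (by positivity) hLn
  have hDe := vexp2 (D / n) (by positivity) hDn
  have ha2 : (n : ℝ) / 2 ≤ ‖(a : ℂ) - lam‖ := by
    refine le_trans ?_ haL
    nlinarith
  have hprod : (n : ℝ) / 2 * θ ≤ ‖(a : ℂ) - lam‖ * ‖(b : ℂ) + (lam - s)‖ := by gcongr
  have hC0' : C0 ≤ ‖(a : ℂ) - lam‖ * ‖(b : ℂ) + (lam - s)‖ * (D / n) := by
    have : C0 = (n : ℝ) / 2 * θ * (D / n) := by rw [hD]; field_simp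
    rw [this]
    gcongr
  have hmain : ((a : ℝ) * Real.exp (-2 * (L / n))) * ((b : ℝ) * Real.exp ((lam - s).re / b - C1 / (b : ℝ) ^ 2)) * Real.exp (-2 * (D / n))
      ≤ ‖(a : ℂ) - lam‖ * ‖(b : ℂ) + (lam - s)‖ * (1 - D / n) := by
    have : (a : ℝ) * Real.exp (-2 * (L / n)) ≤ ‖(a : ℂ) - lam‖ := le_trans (by gcongr) haL
    gcongr
  refine le_trans (le_trans ?_ hmain) (by linarith)
  have : ((a : ℝ) * Real.exp (-2 * (L / n))) * ((b : ℝ) * Real.exp ((lam - s).re / b - C1 / (b : ℝ) ^ 2)) * Real.exp (-2 * (D / n))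
      = a * b * (Real.exp (-2 * (L / n) + ((lam - s).re / b - C1 / (b : ℝ) ^ 2) + (-2 * (D / n)))) := by
    rw [Real.exp_add, Real.exp_add]; ring
  rw [this]
  gcongr
  have f1 : (C1 + 2 * L + 2 * D) / n = C1 / n + 2 * (L / n) + 2 * (D / n) := by ring
  have f2 : C1 / (b : ℝ) ^ 2 ≤ (C1 + 2 * L + 2 * D) / (b : ℝ) ^ 2 := by gcongr; linarith
  have f3 : 0 ≤ C1 / n := by positivity
  linarith

theorem vpow_cmp (s : ℤ) (n k : ℕ) (hn : 1 ≤ n) (hk : k ≤ n) :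
    (n : ℝ) ^ s ≤ 2 ^ s.natAbs * ((n + k : ℕ) : ℝ) ^ s := by
  have hn0 : (0 : ℝ) < n := by exact_mod_cast hn
  have h1 : (n : ℝ) ≤ (n + k : ℕ) := by exact_mod_cast Nat.le_add_right n k
  have h2 : ((n + k : ℕ) : ℝ) ≤ 2 * n := by exact_mod_cast (show n + k ≤ 2 * n by omega)
  have h0 : (0 : ℝ) < (n + k : ℕ) := by linarith
  rcases le_total 0 s with h | h
  · obtain ⟨p, rfl⟩ := Int.eq_ofNat_of_zero_le h
    rw [zpow_natCast, zpow_natCast]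
    calc (n : ℝ) ^ p ≤ ((n + k : ℕ) : ℝ) ^ p := by gcongr
      _ ≤ _ := le_mul_of_one_le_left (by positivity) (one_le_pow₀ (by norm_num))
  · obtain ⟨p, hp⟩ := Int.eq_ofNat_of_zero_le (show 0 ≤ -s by omega)
    obtain rfl : s = -p := by omega
    rw [zpow_neg, zpow_neg, zpow_natCast, zpow_natCast, Int.natAbs_neg, Int.natAbs_natCast,
      ← div_eq_mul_inv, inv_eq_one_div, div_le_div_iff₀ (by positivity) (by positivity), one_mul, ← mul_pow]
    gcongr

set_option maxHeartbeats 1000000 in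
theorem vtail_bd (s : ℤ) (lam x₁ x₂ x₃ : ℂ) (hx : x₁ + x₂ + x₃ = (s : ℂ))
    (hre : 0 < (lam + 1 - (s : ℂ)).re) (δ : ℝ) (hδ0 : 0 < δ) (hδ1 : δ ≤ 1) (hδ : δ ≤ (lam + 1 - (s : ℂ)).re) :
    ∃ C : ℝ, ∃ N : ℕ, 0 ≤ C ∧ ∀ n ≥ N, ∀ k ≤ n, 1 ≤ (k : ℤ) + s →
      ‖(n : ℂ) ^ (2 * s) * ((n + k).factorial / (n - k).factorial * vtau s lam x₁ x₂ x₃ n k)‖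
        ≤ C * ((n : ℝ) / (n - k + 1)) ^ (1 - δ) := by
  obtain ⟨C1, N1, hC1, hN1, hlow⟩ := vtail_low s lam x₁ x₂ x₃ hx hre
  obtain ⟨Z, hZ0, hZ⟩ := vsq_bdd
  obtain ⟨N2, hN2⟩ := vfac_bd s
  refine ⟨2 ^ s.natAbs * 4 * (Real.exp (C1 * Z + C1 * 2 + 1) * 2), max (max N1 N2) (s.natAbs + 1), by positivity, ?_⟩
  intro n hn k hk hks
  have hnN1 : N1 ≤ n := ((le_max_left _ _).trans (le_max_left _ _)).trans hn
  have hnN2 : N2 ≤ n := ((le_max_right _ _).trans (le_max_left _ _)).trans hn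
  have hns : s.natAbs + 1 ≤ n := (le_max_right _ _).trans hn
  have hn0 : (0 : ℝ) < n := by exact_mod_cast (show 0 < n by omega)
  obtain ⟨M, hM⟩ := Int.eq_ofNat_of_zero_le (show 0 ≤ (k : ℤ) + s by omega)
  have e2 : ((k : ℤ) + s).toNat = M := by omega
  set d := n - k with hd
  have hdk : (n : ℝ) - k = d := by rw [hd, Nat.cast_sub hk]
  unfold vtau
  rw [if_pos (by omega), e2]
  -- lower bound of the product
  set P := ∏ i ∈ range M, ‖vq lam x₁ x₂ x₃ k (n + 1 + i)‖ with hP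
  have hMn : (M : ℝ) ≤ 2 * n := by exact_mod_cast (show M ≤ 2 * n by omega)
  have hf1 : ∏ i ∈ range M, ((n + 1 + i : ℕ) : ℝ) = (n + M).factorial / n.factorial := by
    rw [eq_div_iff (by positivity), mul_comm]
    have := Nat.factorial_mul_ascFactorial n M
    rw [← this, Nat.ascFactorial_eq_prod_range]
    push_cast; rfl
  have hf2 : ∏ i ∈ range M, ((d + 1 + i : ℕ) : ℝ) = (d + M).factorial / d.factorial := by
    rw [eq_div_iff (by positivity), mul_comm]
    have := Nat.factorial_mul_ascFactorial d M
    rw [← this, Nat.ascFactorial_eq_prod_range]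
    push_cast; rfl
  set X : ℝ := ((d : ℝ) + 1) with hX
  have hX0 : 0 < X := by positivity
  have hdM : (0 : ℝ) < (d + M : ℕ) := by exact_mod_cast (show 0 < d + M by omega)
  have hexp : ∑ i ∈ range M, ((lam - s).re / ((d + 1 + i : ℕ) : ℝ) - C1 / ((d + 1 + i : ℕ) : ℝ) ^ 2 - C1 / n)
      ≥ -(1 - δ) * (1 + Real.log (d + M : ℕ) - Real.log X) - C1 * Z - C1 * 2 := by
    rw [sum_sub_distrib, sum_sub_distrib]
    have a1 : ∑ i ∈ range M, (lam - s).re / ((d + 1 + i : ℕ) : ℝ) ≥ -(1 - δ) * (1 + Real.log (d + M : ℕ) - Real.log X) := by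
      have b1 := vharm d M
      have b2 := harmonic_le_one_add_log (d + M)
      have b3 := log_add_one_le_harmonic d
      have b4 : ((d + 1 : ℕ) : ℝ) = X := by rw [hX]; push_cast; rfl
      rw [b4] at b3
      calc _ ≥ ∑ i ∈ range M, -(1 - δ) * (1 / ((d + 1 + i : ℕ) : ℝ)) := by
            refine sum_le_sum fun i _ => ?_
            have : -(1 - δ) ≤ (lam - s).re := by simp at hδ ⊢; linarith
            have h0 : 0 ≤ 1 / ((d + 1 + i : ℕ) : ℝ) := by positivity
            calc _ ≤ (lam - s).re * (1 / ((d + 1 + i : ℕ) : ℝ)) := mul_le_mul_of_nonneg_right this h0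
              _ = _ := by ring
        _ ≥ _ := by
            rw [← mul_sum, b1]
            have : 0 ≤ 1 - δ := by linarith
            nlinarith
    have a2 : ∑ i ∈ range M, C1 / ((d + 1 + i : ℕ) : ℝ) ^ 2 ≤ C1 * Z := by
      calc _ = C1 * ∑ i ∈ range M, 1 / ((d + 1 + i : ℕ) : ℝ) ^ 2 := by
            rw [mul_sum]; refine sum_congr rfl fun i _ => by rw [div_eq_mul_one_div]
        _ ≤ _ := by gcongr; exact hZ d M
    have a3 : ∑ i ∈ range M, C1 / (n : ℝ) ≤ C1 * 2 := by
      rw [sum_const, card_range, nsmul_eq_mul, mul_div_assoc', div_le_iff₀ hn0]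
      nlinarith
    linarith
  set Y : ℝ := Real.exp (-(1 - δ) * (1 + Real.log (d + M : ℕ) - Real.log X) - C1 * Z - C1 * 2) with hY
  have hY0 : 0 < Y := Real.exp_pos _
  have hPlow : ((n + M).factorial / n.factorial : ℝ) * ((d + M).factorial / d.factorial) * Y ≤ P := by
    rw [← hf1, ← hf2]
    calc _ ≤ (∏ i ∈ range M, ((n + 1 + i : ℕ) : ℝ)) * (∏ i ∈ range M, ((d + 1 + i : ℕ) : ℝ)) *
          Real.exp (∑ i ∈ range M, ((lam - s).re / ((d + 1 + i : ℕ) : ℝ) - C1 / ((d + 1 + i : ℕ) : ℝ) ^ 2 - C1 / n)) := by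
          gcongr
          exact Real.exp_le_exp.2 hexp
      _ = ∏ i ∈ range M, (((n + 1 + i : ℕ) : ℝ) * ((d + 1 + i : ℕ) : ℝ) * Real.exp ((lam - s).re / ((d + 1 + i : ℕ) : ℝ) - C1 / ((d + 1 + i : ℕ) : ℝ) ^ 2 - C1 / n)) := by
          rw [Real.exp_sum, prod_mul_distrib, prod_mul_distrib]
      _ ≤ P := by
          refine prod_le_prod (fun i _ => by positivity) fun i _ => ?_
          exact hlow n hnN1 k hk i
  have hnorm : ‖(n : ℂ) ^ (2 * s) * ((n + k).factorial / d.factorial * (∏ i ∈ range M, vq lam x₁ x₂ x₃ k (n + 1 + i))⁻¹)‖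
      = (n : ℝ) ^ s * (n : ℝ) ^ s * ((n + k).factorial / d.factorial) / P := by
    rw [norm_mul, norm_mul, norm_inv, norm_div, norm_zpow, Complex.norm_natCast, Complex.norm_natCast, Complex.norm_natCast, norm_prod, two_mul, zpow_add₀ hn0.ne']
    rw [div_eq_mul_inv _ P]; ring
  rw [hnorm]
  have hP0 : 0 < ((n + M).factorial / n.factorial : ℝ) * ((d + M).factorial / d.factorial) * Y := by positivity
  -- factorial comparisons
  obtain ⟨_, g1⟩ := hN2 n hnN2
  obtain ⟨_, g2⟩ := hN2 (n + k) (by omega)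
  have i1 : ((n : ℤ) + s).toNat = d + M := by omega
  have i2 : (((n + k : ℕ) : ℤ) + s).toNat = n + M := by push_cast; omega
  rw [i1] at g1
  rw [i2] at g2
  have g3 := vpow_cmp s n k (by omega) hk
  have hnum : (n : ℝ) ^ s * (n : ℝ) ^ s * ((n + k).factorial / d.factorial)
      ≤ (2 ^ s.natAbs * 4) * (((n + M).factorial / n.factorial : ℝ) * ((d + M).factorial / d.factorial)) := by
    have : (n : ℝ) ^ s * (n : ℝ) ^ s * ((n + k).factorial / d.factorial)
        = (n.factorial * (n : ℝ) ^ s) * ((n : ℝ) ^ s * (n + k).factorial) / (n.factorial * d.factorial) := by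
      field_simp
    rw [this]
    calc _ ≤ (2 * ((d + M).factorial : ℝ)) * ((2 ^ s.natAbs * ((n + k : ℕ) : ℝ) ^ s) * (n + k).factorial) / (n.factorial * d.factorial) := by
          gcongr
      _ = (2 * ((d + M).factorial : ℝ)) * (2 ^ s.natAbs * ((n + k).factorial * ((n + k : ℕ) : ℝ) ^ s)) / (n.factorial * d.factorial) := by ring
      _ ≤ (2 * ((d + M).factorial : ℝ)) * (2 ^ s.natAbs * (2 * (n + M).factorial)) / (n.factorial * d.factorial) := by
          gcongr
      _ = _ := by field_simp; ring
  set U := ((n + M).factorial / n.factorial : ℝ) * ((d + M).factorial / d.factorial) with hU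
  have hU0 : 0 < U := by positivity
  calc _ ≤ (2 ^ s.natAbs * 4) * U / (U * Y) := by gcongr
    _ = (2 ^ s.natAbs * 4) * Y⁻¹ := by field_simp
    _ ≤ (2 ^ s.natAbs * 4) * (Real.exp (C1 * Z + C1 * 2 + 1) * 2 * ((n : ℝ) / X) ^ (1 - δ)) := by
        gcongr
        rw [hY, ← Real.exp_neg]
        have h2n : ((d + M : ℕ) : ℝ) ≤ 2 * n := by exact_mod_cast (show d + M ≤ 2 * n by omega)
        have hl2 : Real.log (d + M : ℕ) ≤ Real.log 2 + Real.log n := by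
          rw [← Real.log_mul (by norm_num) hn0.ne']
          exact Real.log_le_log hdM h2n
        have : ((n : ℝ) / X) ^ (1 - δ) = Real.exp ((Real.log n - Real.log X) * (1 - δ)) := by
          rw [Real.rpow_def_of_pos (by positivity), Real.log_div hn0.ne' hX0.ne']
        rw [this]
        have h2e : Real.exp (Real.log 2) = 2 := Real.exp_log (by norm_num)
        have l2 : 0 ≤ Real.log 2 := Real.log_nonneg (by norm_num)
        have h3 : Real.exp (C1 * Z + C1 * 2 + 1) * 2 * Real.exp ((Real.log n - Real.log X) * (1 - δ))
            = Real.exp (C1 * Z + C1 * 2 + 1 + Real.log 2 + (Real.log n - Real.log X) * (1 - δ)) := by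
          rw [Real.exp_add (C1 * Z + C1 * 2 + 1 + Real.log 2), Real.exp_add _ (Real.log 2), h2e]
        rw [h3]
        apply Real.exp_le_exp.2
        have h4 : 0 ≤ 1 - δ := by linarith
        have h5 := mul_le_mul_of_nonneg_left hl2 h4
        nlinarith
    _ = _ := by rw [hX, hdk]; ring


theorem vfactor_up (lam : ℂ) (J : ℕ) (hJ : 1 ≤ J) :
    ‖(J : ℂ) - lam‖ ≤ J * Real.exp (-lam.re / J + ‖lam‖ ^ 2 / 2 / (J : ℝ) ^ 2) := by
  have hJ0 : (0 : ℝ) < J := by exact_mod_cast hJ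
  have hJc : (J : ℂ) ≠ 0 := by exact_mod_cast (show J ≠ 0 by omega)
  have h := vup (-lam / J)
  have e : (J : ℂ) - lam = J * (1 + -lam / J) := by field_simp; ring
  rw [e, norm_mul, Complex.norm_natCast]
  gcongr
  refine h.trans (le_of_eq ?_)
  congr 1
  rw [norm_div, norm_neg, Complex.norm_natCast, div_pow, Complex.div_natCast_re, Complex.neg_re]
  ring

theorem vqW_up (s : ℤ) (lam x₁ x₂ x₃ : ℂ) (hx : x₁ + x₂ + x₃ = (s : ℂ)) :
    ∃ D : ℝ, 0 ≤ D ∧ ∀ k m j : ℕ, (k : ℤ) + s - 1 = m → j < m →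
      ‖vq lam x₁ x₂ x₃ k (j + 1)‖ ≤
        (((j + 1 : ℕ) : ℝ) * Real.exp (-lam.re / ((j + 1 : ℕ) : ℝ) + D / ((j + 1 : ℕ) : ℝ) ^ 2)) *
        (((m - 1 - j + 1 : ℕ) : ℝ) * Real.exp (-lam.re / ((m - 1 - j + 1 : ℕ) : ℝ) + D / ((m - 1 - j + 1 : ℕ) : ℝ) ^ 2)) := by
  obtain ⟨C0, hC0, hc⟩ := vc_bdd lam ((x₁ - lam) * (x₂ - lam) * (x₃ - lam))
  set A : ℝ := ‖lam‖ ^ 2 / 2 with hA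
  have hA0 : 0 ≤ A := by positivity
  set B : ℝ := C0 * Real.exp (2 * |lam.re|) with hB
  have hB0 : 0 ≤ B := by positivity
  refine ⟨A + B, by positivity, ?_⟩
  intro k m j hm hj
  have hmc : (s : ℂ) + k = m + 1 := by
    have : s + k = m + 1 := by omega
    exact_mod_cast this
  set J : ℕ := j + 1 with hJ
  set J' : ℕ := m - 1 - j + 1 with hJ'
  have hJJ : (J : ℂ) + J' = m + 1 := by exact_mod_cast (show J + J' = m + 1 by omega)
  have hJ1 : (1 : ℝ) ≤ J := by exact_mod_cast (show 1 ≤ J by omega)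
  have hJ1' : (1 : ℝ) ≤ J' := by exact_mod_cast (show 1 ≤ J' by omega)
  have hJ0 : (0 : ℝ) < J := by linarith
  have hJ0' : (0 : ℝ) < J' := by linarith
  have hq : vq lam x₁ x₂ x₃ k (j + 1) = -((J - lam) * (J' - lam)) - (x₁ - lam) * (x₂ - lam) * (x₃ - lam) / (lam + k) := by
    have e1 : (j : ℂ) + 1 = J := by rw [hJ]; push_cast; rfl
    unfold vq
    rw [hx, e1]
    linear_combination (-(J - lam)) * hmc + (J - lam) * hJJ
  have f1 := vfactor_up lam J (by omega)
  have f2 := vfactor_up lam J' (by omega)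
  rw [← hA] at f1 f2
  have hn : ‖vq lam x₁ x₂ x₃ k (j + 1)‖ ≤ ‖(J : ℂ) - lam‖ * ‖(J' : ℂ) - lam‖ + C0 := by
    rw [hq, ← norm_mul]
    refine (norm_sub_le _ _).trans ?_
    rw [norm_neg]
    linarith [hc k]
  set E : ℝ := (-lam.re / J + A / (J : ℝ) ^ 2) + (-lam.re / J' + A / (J' : ℝ) ^ 2) with hE
  have hprod : ‖(J : ℂ) - lam‖ * ‖(J' : ℂ) - lam‖ ≤ J * J' * Real.exp E := by
    calc _ ≤ (J * Real.exp (-lam.re / J + A / (J : ℝ) ^ 2)) * (J' * Real.exp (-lam.re / J' + A / (J' : ℝ) ^ 2)) := by gcongr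
      _ = _ := by rw [hE, Real.exp_add (-lam.re / J + A / (J : ℝ) ^ 2)]; ring
  have hr : ∀ y : ℝ, 1 ≤ y → -|lam.re| ≤ -lam.re / y := by
    intro y hy
    rw [le_div_iff₀ (by linarith)]
    have := le_abs_self lam.re
    nlinarith [abs_nonneg lam.re]
  have hElow : Real.exp (-(2 * |lam.re|)) ≤ Real.exp E := by
    apply Real.exp_le_exp.2
    have := hr J hJ1
    have := hr J' hJ1'
    have : 0 ≤ A / (J : ℝ) ^ 2 := by positivity
    have : 0 ≤ A / (J' : ℝ) ^ 2 := by positivity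
    linarith
  set w : ℝ := 1 / (J : ℝ) ^ 2 + 1 / (J' : ℝ) ^ 2 with hw
  have hw0 : 0 ≤ w := by positivity
  have hw1 : 1 ≤ J * J' * w := by
    have : (J : ℝ) * J' * w = ((J' : ℝ) ^ 2 + (J : ℝ) ^ 2) / (J * J') := by rw [hw]; field_simp
    rw [this, le_div_iff₀ (by positivity)]
    nlinarith [sq_nonneg ((J : ℝ) - J')]
  have hC : C0 ≤ J * J' * Real.exp E * (B * w) := by
    calc C0 = 1 * Real.exp (-(2 * |lam.re|)) * B := by
          rw [hB, Real.exp_neg]; field_simp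
      _ ≤ (J * J' * w) * Real.exp E * B := by gcongr
      _ = _ := by ring
  calc _ ≤ J * J' * Real.exp E * (B * w + 1) := by linarith
    _ ≤ J * J' * Real.exp E * Real.exp (B * w) := by
        gcongr; exact Real.add_one_le_exp _
    _ = J * J' * Real.exp (E + B * w) := by rw [Real.exp_add E]; ring
    _ = J * J' * Real.exp ((-lam.re / J + (A + B) / (J : ℝ) ^ 2) + (-lam.re / J' + (A + B) / (J' : ℝ) ^ 2)) := by
        congr 2; rw [hE, hw]; ring
    _ = _ := by rw [Real.exp_add]; ring

theorem vW_bd (s : ℤ) (lam x₁ x₂ x₃ : ℂ) (hx : x₁ + x₂ + x₃ = (s : ℂ)) :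
    ∃ C : ℝ, ∃ K : ℕ, 0 ≤ C ∧ 1 ≤ K ∧ ∀ k ≥ K,
      ‖vW s lam x₁ x₂ x₃ k‖ ≤ C * (k.factorial : ℝ) ^ 2 * (k : ℝ) ^ (-2 * (lam + 1 - s).re) := by
  obtain ⟨D, hD, hq⟩ := vqW_up s lam x₁ x₂ x₃ hx
  obtain ⟨Z, hZ0, hZ⟩ := vsq_bdd
  obtain ⟨N, hN⟩ := vfac_bd (s - 1)
  set r := lam.re with hr
  set G : ℝ := |r| + |r| * Real.log 2 + D * Z with hG
  refine ⟨(2 * Real.exp G) ^ 2, max N (2 * s.natAbs + 4), by positivity, by omega, ?_⟩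
  intro k hk
  have hkN : N ≤ k := (le_max_left _ _).trans hk
  have hks : 2 * s.natAbs + 4 ≤ k := (le_max_right _ _).trans hk
  obtain ⟨m, hm⟩ := Int.eq_ofNat_of_zero_le (show 0 ≤ (k : ℤ) + s - 1 by omega)
  have hk0 : (0 : ℝ) < k := by exact_mod_cast (show 0 < k by omega)
  have hm0 : (0 : ℝ) < m := by exact_mod_cast (show 0 < m by omega)
  have hmk : (m : ℝ) ≤ 2 * k := by exact_mod_cast (show m ≤ 2 * k by omega)
  have hkm : (k : ℝ) ≤ 2 * m := by exact_mod_cast (show k ≤ 2 * m by omega)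
  obtain ⟨g, _⟩ := hN k hkN
  have e1 : ((k : ℤ) + (s - 1)).toNat = m := by omega
  rw [e1] at g
  unfold vW
  rw [if_pos (by omega)]
  have e2 : ((k : ℤ) + s - 1).toNat = m := by omega
  rw [e2, norm_prod]
  set f : ℕ → ℝ := fun j => ((j + 1 : ℕ) : ℝ) * Real.exp (-r / ((j + 1 : ℕ) : ℝ) + D / ((j + 1 : ℕ) : ℝ) ^ 2) with hf
  have h1 : ∏ j ∈ range m, ‖vq lam x₁ x₂ x₃ k (j + 1)‖ ≤ (∏ j ∈ range m, f j) ^ 2 := by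
    calc _ ≤ ∏ j ∈ range m, (f j * f (m - 1 - j)) :=
          prod_le_prod (fun i _ => norm_nonneg _) fun j hj => hq k m j hm (mem_range.1 hj)
      _ = _ := by rw [prod_mul_distrib, prod_range_reflect, sq]
  have hfp : ∏ j ∈ range m, f j = m.factorial * Real.exp (∑ j ∈ range m, (-r / ((j + 1 : ℕ) : ℝ) + D / ((j + 1 : ℕ) : ℝ) ^ 2)) := by
    rw [hf, prod_mul_distrib, Real.exp_sum, ← prod_range_add_one_eq_factorial]
    push_cast; rfl
  have hlog : |Real.log k - Real.log m| ≤ Real.log 2 := by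
    have a1 := Real.log_le_log hm0 hmk
    have a2 := Real.log_le_log hk0 hkm
    rw [Real.log_mul (by norm_num) (by positivity)] at a1 a2
    rw [abs_le]; constructor <;> linarith
  have hH : |(harmonic m : ℝ) - Real.log m| ≤ 1 := by
    have b2 := harmonic_le_one_add_log m
    have b3 := log_add_one_le_harmonic m
    have b4 : Real.log m ≤ Real.log ((m + 1 : ℕ) : ℝ) := Real.log_le_log hm0 (by push_cast; linarith)
    rw [abs_le]; constructor <;> linarith
  have hsum : ∑ j ∈ range m, (-r / ((j + 1 : ℕ) : ℝ) + D / ((j + 1 : ℕ) : ℝ) ^ 2) ≤ G - r * Real.log k := by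
    have c1 := vharm 0 m
    have c2 := hZ 0 m
    have c3 : ∑ j ∈ range m, (-r / ((j + 1 : ℕ) : ℝ) + D / ((j + 1 : ℕ) : ℝ) ^ 2)
        = -r * (harmonic m : ℝ) + D * ∑ i ∈ range m, 1 / ((0 + 1 + i : ℕ) : ℝ) ^ 2 := by
      have : (harmonic m : ℝ) = ∑ i ∈ range m, 1 / ((0 + 1 + i : ℕ) : ℝ) := by rw [c1]; simp
      rw [this, mul_sum, mul_sum, ← sum_add_distrib]
      refine sum_congr rfl fun i _ => ?_
      rw [show 0 + 1 + i = i + 1 by omega]; ring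
    rw [c3]
    have c4 : D * ∑ i ∈ range m, 1 / ((0 + 1 + i : ℕ) : ℝ) ^ 2 ≤ D * Z := by gcongr
    have c5 : -r * ((harmonic m : ℝ) - Real.log m) ≤ |r| := by
      calc _ ≤ |-r * ((harmonic m : ℝ) - Real.log m)| := le_abs_self _
        _ = |r| * |(harmonic m : ℝ) - Real.log m| := by rw [abs_mul, abs_neg]
        _ ≤ |r| * 1 := by gcongr
        _ = _ := by ring
    have c6 : r * (Real.log k - Real.log m) ≤ |r| * Real.log 2 := by
      calc _ ≤ |r * (Real.log k - Real.log m)| := le_abs_self _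
        _ = |r| * |Real.log k - Real.log m| := by rw [abs_mul]
        _ ≤ _ := by gcongr
    rw [hG]; linarith
  have hfb : ∏ j ∈ range m, f j ≤ (2 * (k.factorial * (k : ℝ) ^ (s - 1))) * Real.exp (G - r * Real.log k) := by
    rw [hfp]
    gcongr
  have hf0 : 0 ≤ ∏ j ∈ range m, f j := prod_nonneg fun j _ => by rw [hf]; positivity
  refine h1.trans ((pow_le_pow_left₀ hf0 hfb 2).trans (le_of_eq ?_))
  have p1 : (k : ℝ) ^ (s - 1) = Real.exp (Real.log k * ((s : ℝ) - 1)) := by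
    rw [← Real.rpow_intCast, Real.rpow_def_of_pos hk0]; push_cast; rfl
  have p2 : (k : ℝ) ^ (-2 * (lam + 1 - s).re) = Real.exp (Real.log k * ((s : ℝ) - 1)) ^ 2 * Real.exp (-(r * Real.log k)) ^ 2 := by
    rw [Real.rpow_def_of_pos hk0, ← mul_pow, ← Real.exp_add, ← Real.exp_nat_mul]
    congr 1
    simp [hr]
    ring
  rw [p1, p2, sub_eq_add_neg G, Real.exp_add]
  ring

theorem vB_bd1 (x : ℂ) : ∃ K : ℕ, ∀ k ≥ K, ‖1 / (x + k)‖ ≤ 2 / k := by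
  obtain ⟨K, hK⟩ := exists_nat_gt (2 * ‖x‖)
  refine ⟨K + 1, fun k hk => ?_⟩
  have h1 : (K : ℝ) + 1 ≤ k := by exact_mod_cast hk
  have hk0 : (0 : ℝ) < k := by have := norm_nonneg x; linarith
  have h2 : (k : ℝ) / 2 ≤ ‖x + k‖ := by
    have := norm_sub_norm_le (k : ℂ) (-x)
    rw [norm_neg, Complex.norm_natCast, sub_neg_eq_add, add_comm (k : ℂ)] at this
    linarith
  rw [norm_div, norm_one]
  calc 1 / ‖x + k‖ ≤ 1 / ((k : ℝ) / 2) := by gcongr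
    _ = 2 / k := by field_simp

theorem vT_bd (s : ℤ) (lam x₁ x₂ x₃ : ℂ) (hx : x₁ + x₂ + x₃ = (s : ℂ))
    (δ : ℝ) (hδ : δ ≤ (lam + 1 - (s : ℂ)).re) :
    ∃ C : ℝ, ∃ K : ℕ, 0 ≤ C ∧ 1 ≤ K ∧ ∀ k ≥ K,
      ‖(-1) ^ k * vW s lam x₁ x₂ x₃ k / (k.factorial : ℂ) ^ 2 * (1 / (x₁ + k) + 1 / (x₂ + k) + 1 / (x₃ + k) - 1 / (lam + k))‖
        ≤ C * (k : ℝ) ^ (-1 - 2 * δ) := by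
  obtain ⟨C, K, hC, hK, hW⟩ := vW_bd s lam x₁ x₂ x₃ hx
  obtain ⟨K1, h1⟩ := vB_bd1 x₁
  obtain ⟨K2, h2⟩ := vB_bd1 x₂
  obtain ⟨K3, h3⟩ := vB_bd1 x₃
  obtain ⟨K4, h4⟩ := vB_bd1 lam
  refine ⟨C * 8, K + K1 + K2 + K3 + K4, by positivity, by omega, ?_⟩
  intro k hk
  have hk1 : (1 : ℝ) ≤ k := by exact_mod_cast (show 1 ≤ k by omega)
  have hk0 : (0 : ℝ) < k := by linarith
  have hW' := hW k (by omega)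
  have hB : ‖1 / (x₁ + k) + 1 / (x₂ + k) + 1 / (x₃ + k) - 1 / (lam + k)‖ ≤ 8 / k := by
    have a1 := h1 k (by omega)
    have a2 := h2 k (by omega)
    have a3 := h3 k (by omega)
    have a4 := h4 k (by omega)
    refine (norm_sub_le _ _).trans ?_
    have b1 := norm_add_le (1 / (x₁ + k) + 1 / (x₂ + k)) (1 / (x₃ + k))
    have b2 := norm_add_le (1 / (x₁ + k)) (1 / (x₂ + k))
    have : (8 : ℝ) / k = 2 / k + 2 / k + 2 / k + 2 / k := by ring
    linarith
  have hn : ‖(-1) ^ k * vW s lam x₁ x₂ x₃ k / (k.factorial : ℂ) ^ 2‖ ≤ C * (k : ℝ) ^ (-2 * δ) := by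
    rw [norm_div, norm_mul, norm_pow, norm_neg, norm_one, one_pow, one_mul, norm_pow, Complex.norm_natCast,
      div_le_iff₀ (by positivity)]
    refine hW'.trans ?_
    have : (k : ℝ) ^ (-2 * (lam + 1 - s).re) ≤ (k : ℝ) ^ (-2 * δ) :=
      Real.rpow_le_rpow_of_exponent_le hk1 (by linarith)
    calc _ ≤ C * (k.factorial : ℝ) ^ 2 * (k : ℝ) ^ (-2 * δ) := by gcongr
      _ = _ := by ring
  rw [norm_mul]
  calc _ ≤ (C * (k : ℝ) ^ (-2 * δ)) * (8 / k) := by gcongr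
    _ = C * 8 * (k : ℝ) ^ (-1 - 2 * δ) := by
      rw [show -1 - 2 * δ = -2 * δ - 1 by ring, Real.rpow_sub_one hk0.ne']; ring

theorem vgpoch_eq (s : ℤ) (lam x₁ x₂ x₃ : ℂ) (k : ℕ) (ξp ξm : ℂ)
    (h1 : ∀ j : ℕ, (ξp + j) * (ξm + j) = vq lam x₁ x₂ x₃ k (j + 1))
    (h2 : ∀ j : ℕ, (ξp - 1 - j) * (ξm - 1 - j) = vq lam x₁ x₂ x₃ k (-j)) :
    gpoch ξp ((k : ℤ) + s - 1) * gpoch ξm ((k : ℤ) + s - 1) = vW s lam x₁ x₂ x₃ k := by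
  unfold gpoch vW
  split_ifs with h
  · rw [← prod_mul_distrib]
    exact prod_congr rfl fun j _ => h1 j
  · rw [← mul_inv, ← prod_mul_distrib]
    congr 1
    exact prod_congr rfl fun j _ => h2 j


/-- Equation (1.7): expansion of the Virasoro–Shapiro-type amplitude with
integer total momentum `s` and free parameter `λ`. -/
theorem virasoro_shapiro_symmetric_int (s : ℤ) (lam x₁ x₂ x₃ : ℂ)
    (hx : x₁ + x₂ + x₃ = (s : ℂ))
    (hre : 0 < (lam + 1 - (s : ℂ)).re)
    (ξp ξm : ℕ → ℂ)
    (hξ : ∀ k : ℕ, ξp k + ξm k = 2 - (s : ℂ) - k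
      ∧ ξp k * ξm k = ((2 - (s : ℂ) - k) / 2) ^ 2
          - (((s : ℂ) + k - 2 * lam) / 2) ^ 2
          - (x₁ - lam) * (x₂ - lam) * (x₃ - lam) / (lam + k))
    (hx₁ : ∀ m : ℕ, x₁ ≠ -(m : ℂ))
    (hx₂ : ∀ m : ℕ, x₂ ≠ -(m : ℂ))
    (hx₃ : ∀ m : ℕ, x₃ ≠ -(m : ℂ))
    (hlam : ∀ m : ℕ, lam ≠ -(m : ℂ))
    (h1x₁ : ∀ m : ℕ, 1 - x₁ ≠ -(m : ℂ))
    (h1x₂ : ∀ m : ℕ, 1 - x₂ ≠ -(m : ℂ))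
    (h1x₃ : ∀ m : ℕ, 1 - x₃ ≠ -(m : ℂ))
    (hgen : ∀ k : ℕ, ∀ j ∈ Finset.range (-((k : ℤ) + s - 1)).toNat,
      ξp k - 1 - (j : ℂ) ≠ 0 ∧ ξm k - 1 - (j : ℂ) ≠ 0) :
    Tendsto (fun N : ℕ => ∑ k ∈ Finset.range N,
        ((-1 : ℂ) ^ (s + 1) * (-1 : ℂ) ^ ((k : ℤ) + s - 1)
            * gpoch (ξp k) ((k : ℤ) + s - 1) * gpoch (ξm k) ((k : ℤ) + s - 1)
            / ((k.factorial : ℂ)) ^ 2)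
        * (1 / (x₁ + k) + 1 / (x₂ + k) + 1 / (x₃ + k) - 1 / (lam + k)))
      atTop
      (𝓝 (Complex.Gamma x₁ * Complex.Gamma x₂ * Complex.Gamma x₃
            / (Complex.Gamma (1 - x₁) * Complex.Gamma (1 - x₂)
              * Complex.Gamma (1 - x₃)))) := by
  have hs1 : ∀ k j : ℕ, (ξp k + j) * (ξm k + j) = vq lam x₁ x₂ x₃ k (j + 1) := by
    intro k j
    obtain ⟨h1, h2⟩ := hξ k
    unfold vq
    rw [hx]
    linear_combination (j : ℂ) * h1 + h2
  have hs2 : ∀ k j : ℕ, (ξp k - 1 - j) * (ξm k - 1 - j) = vq lam x₁ x₂ x₃ k (-j) := by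
    intro k j
    obtain ⟨h1, h2⟩ := hξ k
    unfold vq
    rw [hx]
    linear_combination (-1 - (j : ℂ)) * h1 + h2
  set T : ℕ → ℂ := fun k => (-1) ^ k * vW s lam x₁ x₂ x₃ k / (k.factorial : ℂ) ^ 2
    * (1 / (x₁ + k) + 1 / (x₂ + k) + 1 / (x₃ + k) - 1 / (lam + k)) with hT
  have hsummand : ∀ k : ℕ, ((-1 : ℂ) ^ (s + 1) * (-1 : ℂ) ^ ((k : ℤ) + s - 1)
            * gpoch (ξp k) ((k : ℤ) + s - 1) * gpoch (ξm k) ((k : ℤ) + s - 1)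
            / ((k.factorial : ℂ)) ^ 2)
        * (1 / (x₁ + k) + 1 / (x₂ + k) + 1 / (x₃ + k) - 1 / (lam + k)) = T k := by
    intro k
    have hsign : (-1 : ℂ) ^ (s + 1) * (-1 : ℂ) ^ ((k : ℤ) + s - 1) = (-1) ^ k := by
      have e : s + 1 + ((k : ℤ) + s - 1) = 2 * s + k := by ring
      rw [← zpow_add₀ (by norm_num), e, zpow_add₀ (by norm_num), zpow_mul, zpow_natCast]
      norm_num
    rw [hT, hsign, mul_assoc ((-1 : ℂ) ^ k),
      vgpoch_eq s lam x₁ x₂ x₃ k (ξp k) (ξm k) (hs1 k) (hs2 k)]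
  simp only [hsummand]
  have nz : ∀ y : ℂ, (∀ m : ℕ, y ≠ -(m : ℂ)) → ∀ j : ℕ, y + j ≠ 0 := by
    intro y hy j h
    exact hy j (eq_neg_of_add_eq_zero_left h)
  set δ : ℝ := min 1 (lam + 1 - (s : ℂ)).re with hδ
  have hδ0 : 0 < δ := lt_min one_pos hre
  have hδ1 : δ ≤ 1 := min_le_left _ _
  have hδ2 : δ ≤ (lam + 1 - (s : ℂ)).re := min_le_right _ _
  obtain ⟨C1, N1, hC1, hb1⟩ := vtail_bd s lam x₁ x₂ x₃ hx hre δ hδ0 hδ1 hδ2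
  obtain ⟨C2, K, hC2, hK, hb2⟩ := vT_bd s lam x₁ x₂ x₃ hx δ hδ2
  obtain ⟨C3, N3, hC3, hN3, hb3⟩ := vtail_low s lam x₁ x₂ x₃ hx hre
  refine vtannery (fun n k => T k * ((n : ℂ) ^ (2 * s) * ((n + k).factorial / (n - k).factorial * vtau s lam x₁ x₂ x₃ n k)))
    T _ δ (C2 * C1) (K + s.natAbs + 1) N1 hδ0 hδ1 (by positivity) (by omega) ?_ ?_ ?_
  · intro k
    simpa using (vpoint s lam x₁ x₂ x₃ k).const_mul (T k)
  · intro n hn k hk hkn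
    have a1 := hb1 n hn k hkn (by omega)
    have a2 := hb2 k (by omega)
    rw [norm_mul]
    calc _ ≤ (C2 * (k : ℝ) ^ (-1 - 2 * δ)) * (C1 * ((n : ℝ) / (n - k + 1)) ^ (1 - δ)) :=
          mul_le_mul a2 a1 (norm_nonneg _) (by positivity)
      _ = _ := by ring
  · refine (vGamma s x₁ x₂ x₃ hx h1x₁ h1x₂ h1x₃).congr' ?_
    filter_upwards [eventually_ge_atTop N3] with n hn
    rw [vfinite s lam x₁ x₂ x₃ hx n (nz _ hx₁) (nz _ hx₂) (nz _ hx₃) (nz _ hlam) ?_ ?_, mul_sum]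
    · refine sum_congr rfl fun k _ => ?_
      rw [hT]; ring
    · intro k hk j _ h0
      have := hb3 n hn k hk j
      rw [h0, norm_zero] at this
      have hpos : (0 : ℝ) < ((n + 1 + j : ℕ) : ℝ) * ((n - k + 1 + j : ℕ) : ℝ)
        * Real.exp ((lam - s).re / ((n - k + 1 + j : ℕ) : ℝ) - C3 / ((n - k + 1 + j : ℕ) : ℝ) ^ 2 - C3 / n) := by
        positivity
      linarith
    · intro k hk j hj
      rw [← hs2 k j]
      obtain ⟨u, v⟩ := hgen k j (mem_range.2 hj)
      exact mul_ne_zero u v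
end

section
/- Let λ ∈ ℂ with Re(λ) > 0 and λ not a nonpositive integer. For each integer k ≥ 0 let ξ_k^+, ξ_k^− ∈ ℂ be any numbers satisfying ξ_k^+ + ξ_k^− = 1/2 − k and ξ_k^+ ξ_k^− = ((1/2−k)/2)² − ((2k+1)/4)² · (k+2−3λ)/(k+λ). Then the series ∑_{k=0}^{∞} [ (−1)^k (ξ_k^+)_k (ξ_k^−)_k / ( k! (3/2)_k ) ] · ( 6/(2k+1) − 1/(λ+k) ) converges and its sum equals π²/2. -/
open Finset Filter Topology Complex

/-- The Pochhammer symbol `(z)_k = z(z+1)⋯(z+k-1)`, with `(z)_0 = 1`. -/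
noncomputable def poch (z : ℂ) (k : ℕ) : ℂ := ∏ j ∈ Finset.range k, (z + j)

noncomputable def DD (l : ℂ) (k : ℕ) (t : ℂ) : ℂ :=
  (t + l) * (t + k + 3 / 2 - l) + (l - 1 / 2) ^ 3 / (k + l)

lemma DD_B (l : ℂ) (k : ℕ) (t : ℂ) (h : (k : ℂ) + l ≠ 0) :
    (t + 1 / 2) ^ 3 + (-((k : ℂ) + 1 / 2) ^ 3 / (k + l)) * (t + l) = (t - k) * DD l k t := by
  unfold DD; field_simp; ring

lemma DD_A (l : ℂ) (k : ℕ) (t : ℂ) (h : (k : ℂ) + l ≠ 0) :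
    (t + 1) ^ 3 + (-((k : ℂ) + 1 / 2) ^ 3 / (k + l)) * (t + 3 / 2 - l)
      = (3 / 2 + t + k) * DD l k (t - k) := by
  unfold DD; field_simp; ring

lemma half_ne (k : ℕ) : (k : ℂ) + 1 / 2 ≠ 0 := by
  intro h
  have h1 := congrArg Complex.re h
  simp at h1
  have : (0 : ℝ) < (k : ℝ) + 2⁻¹ := by positivity
  linarith

lemma DD_S (l : ℂ) (k : ℕ) (t : ℂ) (h : (k : ℂ) + l ≠ 0) :
    (k + l) * DD l k t = (l - 1 / 2) * (((k : ℂ) + 1 / 2) ^ 2 + (k + 1 / 2) * (t + 1 / 2)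
      + (t + 1 / 2) ^ 2) + (k + 1 / 2) * (t + 1 / 2) * ((k + 1 / 2) + (t + 1 / 2)) := by
  unfold DD; field_simp; ring

lemma DD_diag (l : ℂ) (k : ℕ) (h : (k : ℂ) + l ≠ 0) :
    DD l k k = ((k : ℂ) + 1 / 2) ^ 3 * (3 / ((k : ℂ) + 1 / 2) - 1 / (k + l)) := by
  have h2 := half_ne k
  refine mul_left_cancel₀ h ?_
  rw [DD_S l k k h]
  have e : (k + l) * (((k : ℂ) + 1 / 2) ^ 3 * (3 / ((k : ℂ) + 1 / 2) - 1 / (k + l)))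
      = 3 * ((k : ℂ) + 1 / 2) ^ 2 * (k + l) - ((k : ℂ) + 1 / 2) ^ 3 := by
    generalize (k : ℂ) + 1 / 2 = x at *
    field_simp
  rw [e]; ring

lemma poch_DD (l : ℂ) (k : ℕ) (h : (k : ℂ) + l ≠ 0) (p q : ℂ) (h1 : p + q = 1 / 2 - (k : ℂ))
    (h2 : p * q = ((1 / 2 - (k : ℂ)) / 2) ^ 2
          - ((2 * (k : ℂ) + 1) / 4) ^ 2 * (((k : ℂ) + 2 - 3 * l) / ((k : ℂ) + l))) :
    poch p k * poch q k = ∏ m ∈ range k, DD l k ((m : ℂ) - k) := by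
  unfold poch
  rw [← prod_mul_distrib, ← prod_range_reflect (fun m : ℕ => DD l k ((m : ℂ) - k))]
  refine prod_congr rfl fun m hm => ?_
  have hm' : m + 1 ≤ k := by simpa using hm
  have e : ((k - 1 - m : ℕ) : ℂ) - k = - (m + 1) := by
    have : k - 1 - m = k - (m + 1) := by omega
    rw [this, Nat.cast_sub hm']; push_cast; ring
  rw [e]
  have : (p + m) * (q + m) = m ^ 2 + (p + q) * m + p * q := by ring
  rw [this, h1, h2]; unfold DD; field_simp; ring

lemma lag (n : ℕ) (d : ℕ → ℂ) (hd : Set.InjOn d (range n)) (h0 : ∀ k ∈ range n, d k ≠ 0)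
    (P : Polynomial ℂ) (hP : P.natDegree ≤ n) :
    P.coeff n = P.eval 0 / ∏ j ∈ range n, (0 - d j)
      + ∑ k ∈ range n, P.eval (d k) / (d k * ∏ j ∈ (range n).erase k, (d k - d j)) := by
  let v : Option ℕ → ℂ := fun o => o.elim 0 d
  have hv : Set.InjOn v (insertNone (range n)) := by
    intro a ha b hb hab
    rcases a with _ | a <;> rcases b with _ | b
    · rfl
    · exact absurd hab.symm (h0 b (by simpa using hb))
    · exact absurd hab (h0 a (by simpa using ha))
    · exact congrArg some (hd (by simpa using ha) (by simpa using hb) hab)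
  have := Lagrange.coeff_eq_sum hv (P := P) (by
    rw [card_insertNone, card_range]
    refine lt_of_le_of_lt Polynomial.degree_le_natDegree ?_
    exact_mod_cast Nat.lt_succ_of_le hP)
  rw [card_insertNone, card_range, Nat.add_sub_cancel] at this
  rw [this, sum_insertNone]
  congr 1
  · have e : (insertNone (range n)).erase none = (range n).map Function.Embedding.some := by
      ext o; rcases o with _ | o <;> simp
    rw [e, prod_map]; rfl
  · refine sum_congr rfl fun k hk => ?_
    have e : (insertNone (range n)).erase (some k) = insertNone ((range n).erase k) := by
      ext o; rcases o with _ | o <;> simp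
    rw [e, prod_insertNone]
    simp [v]

lemma fin_generic (l : ℂ) (N : ℕ) (hl : ∀ j : ℕ, (j : ℂ) + l ≠ 0)
    (hD : ∀ k ∈ range (N + 1), ∀ j ∈ range (N + 1), DD l k (j : ℂ) ≠ 0) :
    ∑ k ∈ range (N + 1), ((∏ j ∈ range (N + 1), ((3 / 2 + j + k) * DD l k ((j : ℂ) - k)))
        / ∏ j ∈ (range (N + 1)).erase k, ((j - k) * DD l k (j : ℂ))) / ((k : ℂ) + 1 / 2) ^ 3
      = ∏ j ∈ range (N + 1), ((j : ℂ) + 1) ^ 3 / ((j : ℂ) + 1 / 2) ^ 3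
        - ∏ j ∈ range (N + 1), ((j : ℂ) + 3 / 2 - l) / (j + l) := by
  have hh := half_ne
  let d : ℕ → ℂ := fun k => -((k : ℂ) + 1 / 2) ^ 3 / (k + l)
  have hd0 : ∀ k, d k ≠ 0 := fun k =>
    div_ne_zero (neg_ne_zero.2 (pow_ne_zero _ (hh k))) (hl k)
  have hsub : ∀ k j : ℕ, d k - d j = ((j - k) * DD l k (j : ℂ)) / (j + l) := by
    intro k j
    rw [← DD_B l k j (hl k)]
    have := hl k; have := hl j
    simp only [d]; field_simp; ring
  have hinj : Set.InjOn d (range (N + 1)) := by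
    intro a ha b hb hab
    have h1 := hsub a b
    rw [hab, sub_self, eq_comm, div_eq_zero_iff] at h1
    rcases h1 with h1 | h1
    · rcases mul_eq_zero.1 h1 with h1 | h1
      · exact_mod_cast (sub_eq_zero.1 h1).symm
      · exact absurd h1 (hD a ha b hb)
    · exact absurd h1 (hl b)
  let P : Polynomial ℂ := ∏ j ∈ range (N + 1),
    (Polynomial.C ((j : ℂ) + 3 / 2 - l) * Polynomial.X + Polynomial.C (((j : ℂ) + 1) ^ 3))
  have hdeg : ∀ j ∈ range (N + 1), (Polynomial.C ((j : ℂ) + 3 / 2 - l) * Polynomial.X + Polynomial.C (((j : ℂ) + 1) ^ 3)).natDegree ≤ 1 :=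
    fun j _ => Polynomial.natDegree_linear_le
  have hPd : P.natDegree ≤ N + 1 := by
    have := Polynomial.natDegree_prod_le (range (N + 1)) (fun j : ℕ => (Polynomial.C ((j : ℂ) + 3 / 2 - l) * Polynomial.X + Polynomial.C (((j : ℂ) + 1) ^ 3)))
    refine this.trans ((sum_le_sum hdeg).trans (by simp))
  have hPc : P.coeff (N + 1) = ∏ j ∈ range (N + 1), ((j : ℂ) + 3 / 2 - l) := by
    have := Polynomial.coeff_prod_of_natDegree_le (s := range (N + 1)) (f := fun j : ℕ => (Polynomial.C ((j : ℂ) + 3 / 2 - l) * Polynomial.X + Polynomial.C (((j : ℂ) + 1) ^ 3))) 1 hdeg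
    rw [card_range, mul_one] at this
    rw [this]
    refine prod_congr rfl fun j _ => ?_
    rw [Polynomial.coeff_add, Polynomial.coeff_C_mul, Polynomial.coeff_X_one, Polynomial.coeff_C]
    simp
  have hPe : ∀ x, P.eval x = ∏ j ∈ range (N + 1), (((j : ℂ) + 1) ^ 3 + x * ((j : ℂ) + 3 / 2 - l)) := by
    intro x
    rw [Polynomial.eval_prod]
    refine prod_congr rfl fun j _ => by simp; ring
  have key := lag (N + 1) d hinj (fun k _ => hd0 k) P hPd
  have hb : ∏ j ∈ range (N + 1), ((j : ℂ) + l) ≠ 0 := prod_ne_zero_iff.2 fun j _ => hl j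
  rw [hPc] at key
  have key2 : ∏ j ∈ range (N + 1), ((j : ℂ) + 3 / 2 - l) / (j + l) = 
     ∏ j ∈ range (N + 1), ((j : ℂ) + 1) ^ 3 / ((j : ℂ) + 1 / 2) ^ 3 - 
     ∑ k ∈ range (N + 1), ((∏ j ∈ range (N + 1), ((3 / 2 + j + k) * DD l k ((j : ℂ) - k)))
        / ∏ j ∈ (range (N + 1)).erase k, ((j - k) * DD l k (j : ℂ))) / ((k : ℂ) + 1 / 2) ^ 3 := by
    rw [prod_div_distrib, key, add_div, sub_eq_add_neg, ← sum_neg_distrib, sum_div]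
    congr 1
    · have e : ∏ j ∈ range (N + 1), (0 - d j) = (∏ j ∈ range (N + 1), ((j : ℂ) + 1 / 2) ^ 3) / ∏ j ∈ range (N + 1), ((j : ℂ) + l) := by
        rw [← prod_div_distrib]
        refine prod_congr rfl fun j _ => by simp only [d]; ring
      rw [e, hPe, prod_div_distrib]
      simp only [zero_mul, add_zero]
      have : ∏ j ∈ range (N + 1), ((j : ℂ) + 1 / 2) ^ 3 ≠ 0 := prod_ne_zero_iff.2 fun j _ => pow_ne_zero _ (hh j)
      generalize ∏ j ∈ range (N + 1), ((j : ℂ) + 1 / 2) ^ 3 = Y at *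
      field_simp
    · refine sum_congr rfl fun k hk => ?_
      have e1 : P.eval (d k) = ∏ j ∈ range (N + 1), ((3 / 2 + j + k) * DD l k ((j : ℂ) - k)) := by
        rw [hPe]; exact prod_congr rfl fun j _ => DD_A l k j (hl k)
      have e2 : ∏ j ∈ (range (N + 1)).erase k, (d k - d j) = (∏ j ∈ (range (N + 1)).erase k, ((j - k) * DD l k (j : ℂ))) / ∏ j ∈ (range (N + 1)).erase k, ((j : ℂ) + l) := by
        rw [← prod_div_distrib]
        exact prod_congr rfl fun j _ => hsub k j
      have e3 := mul_prod_erase (range (N + 1)) (fun j : ℕ => (j : ℂ) + l) hk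
      have e4 : ∏ j ∈ (range (N + 1)).erase k, ((j : ℂ) + l) ≠ 0 := prod_ne_zero_iff.2 fun j _ => hl j
      have e5 : ∏ j ∈ (range (N + 1)).erase k, ((j - k) * DD l k (j : ℂ)) ≠ 0 := by
        refine prod_ne_zero_iff.2 fun j hj => mul_ne_zero ?_ (hD k hk j (mem_of_mem_erase hj))
        rw [sub_ne_zero]; exact_mod_cast ne_of_mem_erase hj
      rw [e1, e2, ← e3]
      simp only [d]
      have := hh k; have := hl k
      generalize (∏ j ∈ (range (N + 1)).erase k, ((j - k) * DD l k (j : ℂ))) = Y at *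
      generalize (∏ j ∈ (range (N + 1)).erase k, ((j : ℂ) + l)) = Z at *
      field_simp
  rw [key2]; ring

lemma prod_erase_split (k M : ℕ) (f : ℕ → ℂ) :
    ∏ j ∈ (range (k + M + 1)).erase k, f j = (∏ j ∈ range k, f j) * ∏ i ∈ range M, f (k + 1 + i) := by
  induction M with
  | zero => simp [range_add_one]
  | succ M ih =>
    have e : (range (k + (M + 1) + 1)).erase k = insert (k + 1 + M) ((range (k + M + 1)).erase k) := by
      ext j; simp; omega
    rw [e, prod_insert (by simp), ih, prod_range_succ]; ring

lemma prod_sub_k (k : ℕ) : ∏ j ∈ range k, ((j : ℂ) - k) = (-1) ^ k * (k.factorial : ℂ) := by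
  rw [← prod_range_add_one_eq_factorial, ← prod_range_reflect]
  push_cast
  rw [← card_range k, ← prod_const, card_range, ← prod_mul_distrib]
  refine prod_congr rfl fun m hm => ?_
  have hm' : m + 1 ≤ k := by simpa using hm
  have : k - 1 - m = k - (m + 1) := by omega
  rw [this, Nat.cast_sub hm']; push_cast; ring

noncomputable def TT (l : ℂ) (k : ℕ) : ℂ :=
  (-1) ^ k * (∏ m ∈ range k, DD l k ((m : ℂ) - k)) / ((k.factorial : ℂ) * poch (3 / 2) k)
    * (3 / ((k : ℂ) + 1 / 2) - 1 / (k + l))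

noncomputable def RR (l : ℂ) (N k : ℕ) : ℂ :=
  ∏ m ∈ range k, ((((N - k : ℕ) : ℂ) + 1 + m) * (((N - k : ℕ) : ℂ) + 1 + m + k + 3 / 2))
    / DD l k (((N - k : ℕ) : ℂ) + 1 + m)

lemma poch_ne (k : ℕ) : poch (3 / 2) k ≠ 0 := by
  refine prod_ne_zero_iff.2 fun j _ h => ?_
  apply half_ne (j + 1)
  push_cast
  rw [← h]; ring

lemma term_eq (l : ℂ) (k M : ℕ) (hl : ∀ j : ℕ, (j : ℂ) + l ≠ 0)
    (hD : ∀ j ∈ range (k + M + 1), DD l k (j : ℂ) ≠ 0) :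
    ((∏ j ∈ range (k + M + 1), ((3 / 2 + j + k) * DD l k ((j : ℂ) - k)))
        / ∏ j ∈ (range (k + M + 1)).erase k, ((j - k) * DD l k (j : ℂ))) / ((k : ℂ) + 1 / 2) ^ 3
      = TT l k * RR l (k + M) k * (poch (3 / 2) (k + M + 1) / ((k + M).factorial : ℂ)) := by
  have hk : k ∈ range (k + M + 1) := mem_range.2 (by omega)
  -- D products
  have d1 : ∏ j ∈ range (k + M + 1), DD l k ((j : ℂ) - k)
      = (∏ m ∈ range k, DD l k ((m : ℂ) - k)) * ∏ i ∈ range (M + 1), DD l k (i : ℂ) := by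
    rw [add_assoc, prod_range_add]
    congr 1
    refine prod_congr rfl fun i _ => ?_
    congr 1; push_cast; ring
  have d2 : ∏ j ∈ range (k + M + 1), DD l k (j : ℂ)
      = (∏ i ∈ range (M + 1), DD l k (i : ℂ)) * ∏ m ∈ range k, DD l k ((M : ℂ) + 1 + m) := by
    rw [show k + M + 1 = (M + 1) + k by ring, prod_range_add]
    congr 1
    refine prod_congr rfl fun i _ => ?_
    congr 1; push_cast; ring
  have d3 := mul_prod_erase (range (k + M + 1)) (fun j : ℕ => DD l k (j : ℂ)) hk
  have d4 : ∏ j ∈ (range (k + M + 1)).erase k, ((j : ℂ) - k)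
      = (-1) ^ k * (k.factorial : ℂ) * (M.factorial : ℂ) := by
    rw [prod_erase_split, prod_sub_k, ← prod_range_add_one_eq_factorial M]
    congr 1
    push_cast
    refine prod_congr rfl fun i _ => ?_
    ring
  have d5 : ((k + M).factorial : ℂ) = (M.factorial : ℂ) * ∏ m ∈ range k, ((M : ℂ) + 1 + m) := by
    rw [← prod_range_add_one_eq_factorial, ← prod_range_add_one_eq_factorial M,
      show k + M = M + k by ring, prod_range_add]
    push_cast
    congr 1
    refine prod_congr rfl fun i _ => ?_
    ring
  have d6 : poch (3 / 2) (k + M + 1) * ∏ m ∈ range k, ((M : ℂ) + 1 + m + k + 3 / 2)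
      = poch (3 / 2) k * ∏ j ∈ range (k + M + 1), ((3 / 2 : ℂ) + j + k) := by
    have h1 : poch (3 / 2) (k + M + 1 + k) = poch (3 / 2) (k + M + 1) * ∏ m ∈ range k, ((M : ℂ) + 1 + m + k + 3 / 2) := by
      unfold poch
      rw [prod_range_add]
      congr 1
      refine prod_congr rfl fun i _ => ?_
      push_cast; ring
    have h2 : poch (3 / 2) (k + (k + M + 1)) = poch (3 / 2) k * ∏ j ∈ range (k + M + 1), ((3 / 2 : ℂ) + j + k) := by
      unfold poch
      rw [prod_range_add]
      congr 1
      refine prod_congr rfl fun i _ => ?_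
      push_cast; ring
    rw [← h1, ← h2, add_comm]
  have n1 : ∏ j ∈ range (k + M + 1), DD l k (j : ℂ) ≠ 0 := prod_ne_zero_iff.2 hD
  have n2 := poch_ne k
  have n3 : (k.factorial : ℂ) ≠ 0 := by exact_mod_cast k.factorial_ne_zero
  have n4 : (M.factorial : ℂ) ≠ 0 := by exact_mod_cast M.factorial_ne_zero
  have n5 : ((k + M).factorial : ℂ) ≠ 0 := by exact_mod_cast (k + M).factorial_ne_zero
  have n6 := half_ne k
  have n7 := hD k hk
  have d7 := DD_diag l k (hl k)
  have d8 : (-1 : ℂ) ^ k * (-1) ^ k = 1 := by rw [← mul_pow]; simp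
  have n8 : (-1 : ℂ) ^ k ≠ 0 := by simp
  unfold TT RR
  rw [Nat.add_sub_cancel_left, prod_div_distrib, prod_mul_distrib, prod_mul_distrib, prod_mul_distrib, d1, d4]
  have d9 : 3 / ((k : ℂ) + 1 / 2) - 1 / (k + l) = DD l k k / ((k : ℂ) + 1 / 2) ^ 3 := by
    rw [d7, mul_div_cancel_left₀ _ (pow_ne_zero _ n6)]
  rw [d9]
  generalize (k : ℂ) + 1 / 2 = a at *
  generalize (∏ m ∈ range k, DD l k ((m : ℂ) - k)) = U at *
  generalize (∏ i ∈ range (M + 1), DD l k (i : ℂ)) = X at *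
  generalize (∏ m ∈ range k, DD l k ((M : ℂ) + 1 + m)) = V at *
  generalize (∏ j ∈ (range (k + M + 1)).erase k, DD l k (j : ℂ)) = E at *
  generalize (∏ j ∈ range (k + M + 1), DD l k (j : ℂ)) = F at *
  generalize (∏ m ∈ range k, ((M : ℂ) + 1 + m)) = G at *
  generalize (∏ m ∈ range k, ((M : ℂ) + 1 + m + k + 3 / 2)) = H at *
  generalize (∏ j ∈ range (k + M + 1), ((3 / 2 : ℂ) + j + k)) = J at *
  generalize DD l k (k : ℂ) = d at *
  generalize poch (3 / 2) (k + M + 1) = p1 at *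
  generalize poch (3 / 2) k = p2 at *
  generalize ((k + M).factorial : ℂ) = f1 at *
  generalize (k.factorial : ℂ) = f2 at *
  generalize (M.factorial : ℂ) = f3 at *
  generalize (-1 : ℂ) ^ k = s at *
  have hX : X ≠ 0 := by rintro rfl; simp at d2; exact n1 d2
  have hV : V ≠ 0 := by rintro rfl; simp at d2; exact n1 d2
  have hE : E ≠ 0 := by rintro rfl; simp at d3; exact n1 d3.symm
  have hG : G ≠ 0 := by rintro rfl; simp at d5; exact n5 d5
  have hJ : J = p1 * H / p2 := by rw [d6]; field_simp
  have hX' : X = d * E / V := by rw [d3, d2]; field_simp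
  rw [hJ, hX', d5]
  field_simp
  linear_combination (-(p1 * H * U)) * d8

lemma fin_id_generic (l : ℂ) (N : ℕ) (hl : ∀ j : ℕ, (j : ℂ) + l ≠ 0)
    (hD : ∀ k ∈ range (N + 1), ∀ j ∈ range (N + 1), DD l k (j : ℂ) ≠ 0) :
    ∑ k ∈ range (N + 1), TT l k * RR l N k = ((N.factorial : ℂ) / poch (3 / 2) (N + 1)) *
      (∏ j ∈ range (N + 1), ((j : ℂ) + 1) ^ 3 / ((j : ℂ) + 1 / 2) ^ 3
        - ∏ j ∈ range (N + 1), ((j : ℂ) + 3 / 2 - l) / (j + l)) := by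
  rw [← fin_generic l N hl hD, mul_sum]
  refine sum_congr rfl fun k hk => ?_
  obtain ⟨M, rfl⟩ : ∃ M, N = k + M := ⟨N - k, by have := mem_range.1 hk; omega⟩
  rw [term_eq l k M hl (hD k hk)]
  have n2 := poch_ne (k + M + 1)
  have n5 : ((k + M).factorial : ℂ) ≠ 0 := by exact_mod_cast (k + M).factorial_ne_zero
  field_simp

lemma ne_of_re (l : ℂ) (h : 0 < l.re) (j : ℕ) : (j : ℂ) + l ≠ 0 := by
  intro h1
  have h1 := congrArg Complex.re h1
  simp at h1
  have : (0 : ℝ) ≤ (j : ℝ) := by positivity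
  linarith

lemma DD_lower (l : ℂ) (h : 0 < l.re) (k n : ℕ) (hk : 1 ≤ k) (hn : 1 ≤ n) :
    (n : ℝ) * (n + k + 3 / 2) ≤ 2 * (k + ‖l‖) * ‖DD l k n‖ := by
  have h1 := congrArg Complex.re (DD_S l k n (ne_of_re l h k))
  set b : ℝ := (n : ℝ) + 1 / 2 with hb
  set a : ℝ := (k : ℝ) + 1 / 2 with ha
  have e : (l - 1 / 2) * (((k : ℂ) + 1 / 2) ^ 2 + (k + 1 / 2) * (n + 1 / 2)
      + ((n : ℂ) + 1 / 2) ^ 2) + (k + 1 / 2) * (n + 1 / 2) * ((k + 1 / 2) + (n + 1 / 2))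
      = (l - (1 / 2 : ℝ)) * ((a ^ 2 + a * b + b ^ 2 : ℝ) : ℂ) + ((a * b * (a + b) : ℝ) : ℂ) := by
    rw [ha, hb]; push_cast; ring
  rw [e, Complex.add_re, Complex.re_mul_ofReal, Complex.ofReal_re, Complex.sub_re, Complex.ofReal_re] at h1
  have h2 := (Complex.re_le_norm ((k + l) * DD l k n))
  rw [norm_mul, h1] at h2
  have h3 : ‖(k : ℂ) + l‖ ≤ k + ‖l‖ := (norm_add_le _ _).trans (by simp)
  have hk' : (1 : ℝ) ≤ k := by exact_mod_cast hk
  have hn' : (1 : ℝ) ≤ n := by exact_mod_cast hn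
  have h4 : ‖(k : ℂ) + l‖ * ‖DD l k n‖ ≤ (k + ‖l‖) * ‖DD l k n‖ :=
    mul_le_mul_of_nonneg_right h3 (norm_nonneg _)
  have ha' : 3 / 2 ≤ a := by rw [ha]; linarith
  have hb' : 3 / 2 ≤ b := by rw [hb]; linarith
  have h5 : 0 ≤ l.re * (a ^ 2 + a * b + b ^ 2) := by positivity
  have h6 : a ^ 2 + a * b + b ^ 2 ≤ a * b * (a + b) := by
    nlinarith [mul_nonneg (sub_nonneg.2 hb') (sq_nonneg a), mul_nonneg (sub_nonneg.2 ha') (sq_nonneg b), sq_nonneg (a - b)]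
  have h7 : (n : ℝ) * (n + k + 3 / 2) ≤ a ^ 2 + a * b + b ^ 2 := by
    rw [ha, hb]; nlinarith
  linarith

lemma DD_ne (l : ℂ) (h : 0 < l.re) (k n : ℕ) (hk : 1 ≤ k) (hn : 1 ≤ n) : DD l k n ≠ 0 := by
  intro h0
  have := DD_lower l h k n hk hn
  rw [h0] at this
  have hk' : (1 : ℝ) ≤ k := by exact_mod_cast hk
  have hn' : (1 : ℝ) ≤ n := by exact_mod_cast hn
  have : (0 : ℝ) < (n : ℝ) * (n + k + 3 / 2) := by positivity
  simp at *
  linarith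

lemma DD_cont (l : ℂ) (h : 0 < l.re) (k : ℕ) (t : ℂ) : ContinuousAt (fun l => DD l k t) l := by
  unfold DD
  have := ne_of_re l h k
  fun_prop (disch := assumption)

lemma fin_id (l : ℂ) (h : 0 < l.re) (N : ℕ) :
    ∑ k ∈ range (N + 1), TT l k * RR l N k = ((N.factorial : ℂ) / poch (3 / 2) (N + 1)) *
      (∏ j ∈ range (N + 1), ((j : ℂ) + 1) ^ 3 / ((j : ℂ) + 1 / 2) ^ 3
        - ∏ j ∈ range (N + 1), ((j : ℂ) + 3 / 2 - l) / (j + l)) := by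
  have c1 : ContinuousAt (fun l => ∑ k ∈ range (N + 1), TT l k * RR l N k) l := by
    refine tendsto_finsetSum _ fun k _ => ContinuousAt.mul ?_ ?_
    · unfold TT
      have h1 : ContinuousAt (fun l => ∏ m ∈ range k, DD l k ((m : ℂ) - k)) l :=
        tendsto_finsetProd _ fun m _ => DD_cont l h k _
      have := ne_of_re l h k
      fun_prop (disch := assumption)
    · unfold RR
      refine tendsto_finsetProd _ fun m hm => ?_
      refine ContinuousAt.div continuousAt_const (DD_cont l h k _) ?_
      have := DD_ne l h k (N - k + 1 + m) (by have := mem_range.1 hm; omega) (by omega)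
      push_cast at this
      exact this
  have c2 : ContinuousAt (fun l => ((N.factorial : ℂ) / poch (3 / 2) (N + 1)) *
      (∏ j ∈ range (N + 1), ((j : ℂ) + 1) ^ 3 / ((j : ℂ) + 1 / 2) ^ 3
        - ∏ j ∈ range (N + 1), ((j : ℂ) + 3 / 2 - l) / (j + l))) l := by
    refine continuousAt_const.mul (continuousAt_const.sub ?_)
    refine tendsto_finsetProd _ fun j _ => ?_
    have := ne_of_re l h j
    change ContinuousAt (fun l : ℂ => ((j : ℂ) + 3 / 2 - l) / (j + l)) l
    fun_prop (disch := assumption)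
  have ev : ∀ᶠ z in 𝓝[≠] l, 0 < z.re :=
    nhdsWithin_le_nhds (Complex.continuous_re.continuousAt.eventually_const_lt h)
  have ev2 : ∀ᶠ z in 𝓝[≠] l, ∀ k ∈ range (N + 1), ∀ j ∈ range (N + 1), 0 < z.re → DD z k (j : ℂ) ≠ 0 := by
    rw [eventually_all_finset]; intro k _
    rw [eventually_all_finset]; intro j _
    set S : ℂ := (((k : ℂ) + 1 / 2) ^ 2 + (k + 1 / 2) * (j + 1 / 2) + ((j : ℂ) + 1 / 2) ^ 2) with hS
    set Q : ℂ := (k + 1 / 2) * (j + 1 / 2) * ((k + 1 / 2) + (j + 1 / 2)) with hQ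
    have hS0 : S ≠ 0 := by
      have : S = (((((k : ℝ) + 1 / 2) ^ 2 + (k + 1 / 2) * (j + 1 / 2) + ((j : ℝ) + 1 / 2) ^ 2) : ℝ) : ℂ) := by
        rw [hS]; push_cast; ring
      rw [this, Complex.ofReal_ne_zero]; positivity
    have : {1 / 2 - Q / S}ᶜ ∈ 𝓝[≠] l := by
      by_cases hc : 1 / 2 - Q / S = l
      · rw [hc]; exact self_mem_nhdsWithin
      · exact mem_nhdsWithin_of_mem_nhds (compl_singleton_mem_nhds (Ne.symm hc))
    filter_upwards [this] with z hz hzr h0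
    apply hz
    have := DD_S z k j (ne_of_re z hzr k)
    rw [h0, mul_zero, ← hS, ← hQ] at this
    rw [Set.mem_singleton_iff]
    field_simp
    linear_combination (-2 : ℂ) * this
  refine tendsto_nhds_unique_of_eventuallyEq (c1.tendsto.mono_left nhdsWithin_le_nhds)
    (c2.tendsto.mono_left (nhdsWithin_le_nhds (s := {l}ᶜ))) ?_
  filter_upwards [ev, ev2] with z hz hz2
  exact fin_id_generic z N (ne_of_re z hz) fun k hk j hj => hz2 k hk j hj hz

lemma exists_sq_bound : ∃ B : ℝ, 0 ≤ B ∧ ∀ k : ℕ, ∑ m ∈ range k, 1 / ((m : ℝ) + 1) ^ 2 ≤ B := by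
  have hs : Summable (fun m : ℕ => 1 / ((m : ℝ) + 1) ^ 2) := by
    have := (summable_nat_add_iff 1).2 (Real.summable_one_div_nat_pow.2 (by norm_num : 1 < 2))
    simpa using this
  exact ⟨∑' m : ℕ, 1 / ((m : ℝ) + 1) ^ 2, tsum_nonneg fun m => by positivity,
    fun k => hs.sum_le_tsum _ fun m _ => by positivity⟩

lemma log_le_sum (k : ℕ) : Real.log ((k : ℝ) + 1) ≤ ∑ m ∈ range k, 1 / ((m : ℝ) + 1) := by
  have := log_add_one_le_harmonic k
  rw [harmonic] at this
  push_cast at this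
  simpa using this

lemma norm_one_add_le (z : ℂ) : ‖1 + z‖ ≤ Real.exp (z.re + ‖z‖ ^ 2 / 2) := by
  have h1 : ‖1 + z‖ ^ 2 = 1 + (2 * z.re + ‖z‖ ^ 2) := by
    rw [Complex.sq_norm, Complex.sq_norm, Complex.normSq_apply, Complex.normSq_apply]
    simp; ring
  have h2 : ‖1 + z‖ ^ 2 ≤ Real.exp (z.re + ‖z‖ ^ 2 / 2) ^ 2 := by
    rw [h1, ← Real.exp_nat_mul]
    have := Real.add_one_le_exp (2 * z.re + ‖z‖ ^ 2)
    have e : ((2 : ℕ) : ℝ) * (z.re + ‖z‖ ^ 2 / 2) = 2 * z.re + ‖z‖ ^ 2 := by push_cast; ring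
    rw [e]; linarith
  exact (sq_le_sq₀ (norm_nonneg _) (Real.exp_pos _).le).1 h2

lemma norm_ge (l : ℂ) (h : 0 < l.re) (k : ℕ) : (k : ℝ) ≤ ‖(k : ℂ) + l‖ := by
  have := Complex.re_le_norm ((k : ℂ) + l)
  simp at this
  linarith

lemma kap (l : ℂ) (h : 0 < l.re) (k : ℕ) (hk : 1 ≤ k) :
    ‖l ^ 2 - (l - 1 / 2) ^ 3 / (k + l)‖ ≤ ‖l‖ ^ 2 + ‖(l - 1 / 2) ^ 3‖ := by
  refine (norm_sub_le _ _).trans ?_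
  rw [norm_pow, norm_div]
  have h1 := norm_ge l h k
  have hk' : (1 : ℝ) ≤ k := by exact_mod_cast hk
  have : ‖(l - 1 / 2) ^ 3‖ / ‖(k : ℂ) + l‖ ≤ ‖(l - 1 / 2) ^ 3‖ :=
    div_le_self (norm_nonneg _) (by linarith)
  linarith

lemma factor_bound (l w : ℂ) (K p q : ℝ) (hw : ‖w‖ ≤ K) (hp : 1 ≤ p) (hq : 1 ≤ q) (h : 0 < l.re) :
    ‖1 + (-l / p - l / q + w / (p * q))‖
      ≤ Real.exp (-l.re * (1 / p) + (K + (‖l‖ + K) ^ 2) * (1 / p ^ 2 + 1 / q ^ 2)) := by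
  refine (norm_one_add_le _).trans (Real.exp_le_exp.2 ?_)
  have hK : 0 ≤ K := (norm_nonneg w).trans hw
  have e0 : -l / p - l / q + w / (p * q) = ((-(1 / p) - 1 / q : ℝ) : ℂ) * l + ((1 / p * (1 / q) : ℝ) : ℂ) * w := by
    push_cast; ring
  set u := 1 / p with hu
  set v := 1 / q with hv
  have eu : 1 / p ^ 2 = u ^ 2 := by rw [hu]; ring
  have ev : 1 / q ^ 2 = v ^ 2 := by rw [hv]; ring
  have u0 : 0 < u := by positivity
  have v0 : 0 < v := by positivity
  have u1 : u ≤ 1 := by rw [hu, div_le_one (by linarith)]; exact hp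
  have v1 : v ≤ 1 := by rw [hv, div_le_one (by linarith)]; exact hq
  rw [e0, eu, ev]
  have hre : (((-u - v : ℝ) : ℂ) * l + ((u * v : ℝ) : ℂ) * w).re = (-u - v) * l.re + u * v * w.re := by
    rw [Complex.add_re, Complex.re_ofReal_mul, Complex.re_ofReal_mul]
  have hn : ‖((-u - v : ℝ) : ℂ) * l + ((u * v : ℝ) : ℂ) * w‖ ≤ (u + v) * (‖l‖ + K) := by
    refine (norm_add_le _ _).trans ?_
    rw [norm_mul, norm_mul, Complex.norm_real, Complex.norm_real, Real.norm_eq_abs, Real.norm_eq_abs,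
      abs_of_neg (by linarith : -u - v < 0), abs_of_pos (by positivity)]
    have h1 : u * v * ‖w‖ ≤ (u + v) * K := by
      have : u * v ≤ u + v := by nlinarith
      exact mul_le_mul this hw (norm_nonneg _) (by positivity)
    linarith
  have hn2 : ‖((-u - v : ℝ) : ℂ) * l + ((u * v : ℝ) : ℂ) * w‖ ^ 2 ≤ ((u + v) * (‖l‖ + K)) ^ 2 :=
    pow_le_pow_left₀ (norm_nonneg _) hn 2
  have hwr : w.re ≤ K := (Complex.re_le_norm w).trans hw
  have h3 : u * v * w.re ≤ K * (u ^ 2 + v ^ 2) := by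
    have h31 : u * v * w.re ≤ u * v * K := mul_le_mul_of_nonneg_left hwr (by positivity)
    have h32 : u * v ≤ u ^ 2 + v ^ 2 := by nlinarith [sq_nonneg (u - v)]
    have := mul_le_mul_of_nonneg_right h32 hK
    linarith
  have h4 : ((u + v) * (‖l‖ + K)) ^ 2 / 2 ≤ (‖l‖ + K) ^ 2 * (u ^ 2 + v ^ 2) := by
    have : (u + v) ^ 2 ≤ 2 * (u ^ 2 + v ^ 2) := by nlinarith [sq_nonneg (u - v)]
    have := mul_le_mul_of_nonneg_right this (sq_nonneg (‖l‖ + K))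
    rw [mul_pow]; linarith
  have h5 : 0 < v * l.re := by positivity
  rw [hre]
  linarith

lemma TT_eq (l : ℂ) (k : ℕ) :
    TT l k = (∏ m ∈ range k, (1 + (-l / (((k : ℝ) - m : ℝ) : ℂ) - l / (((m : ℝ) + 3 / 2 : ℝ) : ℂ)
      + (l ^ 2 - (l - 1 / 2) ^ 3 / (k + l)) / ((((k : ℝ) - m : ℝ) : ℂ) * (((m : ℝ) + 3 / 2 : ℝ) : ℂ)))))
      * (3 / ((k : ℂ) + 1 / 2) - 1 / (k + l)) := by
  unfold TT
  congr 1
  have h1 : (-1 : ℂ) ^ k * (k.factorial : ℂ) * poch (3 / 2) k = ∏ m ∈ range k, (((m : ℂ) - k) * (3 / 2 + m)) := by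
    rw [prod_mul_distrib, prod_sub_k]; rfl
  have h2 : (-1 : ℂ) ^ k * (-1) ^ k = 1 := by rw [← mul_pow]; simp
  have n2 := poch_ne k
  have n3 : (k.factorial : ℂ) ≠ 0 := by exact_mod_cast k.factorial_ne_zero
  rw [div_eq_iff (mul_ne_zero n3 n2)]
  have h3 : (k.factorial : ℂ) * poch (3 / 2) k = (-1 : ℂ) ^ k * ∏ m ∈ range k, (((m : ℂ) - k) * (3 / 2 + m)) := by
    rw [← h1]; linear_combination (-(k.factorial : ℂ) * poch (3 / 2) k) * h2
  rw [h3, mul_left_comm, ← prod_mul_distrib]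
  congr 1
  refine prod_congr rfl fun m hm => ?_
  have hm' := mem_range.1 hm
  have m1 : ((k : ℂ) - m) ≠ 0 := by
    rw [sub_ne_zero]; exact_mod_cast hm'.ne'
  have m2 : ((m : ℂ) + 3 / 2) ≠ 0 := by
    have := half_ne (m + 1)
    push_cast at this
    intro h; apply this; rw [← h]; ring
  push_cast
  unfold DD
  have e : ((m : ℂ) - k) * (3 / 2 + m) = - (((k : ℂ) - m) * (m + 3 / 2)) := by ring
  rw [e]
  have e2 : (m : ℂ) - k + k + 3 / 2 - l = m + 3 / 2 - l := by ring
  have e3 : (m : ℂ) - k + l = - ((k : ℂ) - m) + l := by ring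
  rw [e2, e3]
  generalize (l - 1 / 2) ^ 3 / (k + l) = w
  generalize (k : ℂ) - m = p at *
  generalize (m : ℂ) + 3 / 2 = q at *
  field_simp; ring

lemma TT_bound (l : ℂ) (h : 0 < l.re) :
    ∃ C : ℝ, ∀ k, ‖TT l k‖ ≤ C * (1 / ((k : ℝ) + 1) ^ (1 + l.re)) := by
  obtain ⟨B, hB0, hB⟩ := exists_sq_bound
  set K := ‖l‖ ^ 2 + ‖(l - 1 / 2) ^ 3‖ with hKdef
  have hK0 : 0 ≤ K := by positivity
  set C := K + (‖l‖ + K) ^ 2 with hC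
  have hC0 : 0 ≤ C := by positivity
  refine ⟨Real.exp (C * (B + B)) * 8 + ‖TT l 0‖, fun k => ?_⟩
  rcases Nat.eq_zero_or_pos k with rfl | hk
  · simp; positivity
  have hk' : (1 : ℝ) ≤ k := by exact_mod_cast hk
  have hle : ‖TT l k‖ ≤ Real.exp (C * (B + B)) * 8 * (1 / ((k : ℝ) + 1) ^ (1 + l.re)) := by
    rw [TT_eq, norm_mul, norm_prod]
    have h1 : ∏ m ∈ range k, ‖(1 + (-l / (((k : ℝ) - m : ℝ) : ℂ) - l / (((m : ℝ) + 3 / 2 : ℝ) : ℂ)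
      + (l ^ 2 - (l - 1 / 2) ^ 3 / (k + l)) / ((((k : ℝ) - m : ℝ) : ℂ) * (((m : ℝ) + 3 / 2 : ℝ) : ℂ))))‖
        ≤ ∏ m ∈ range k, Real.exp (-l.re * (1 / ((k : ℝ) - m)) + C * (1 / ((k : ℝ) - m) ^ 2 + 1 / ((m : ℝ) + 3 / 2) ^ 2)) := by
      refine prod_le_prod (fun _ _ => norm_nonneg _) fun m hm => ?_
      have hm' : m + 1 ≤ k := by simpa using hm
      have hm'' : (m : ℝ) + 1 ≤ k := by exact_mod_cast hm'
      refine factor_bound l _ K _ _ (kap l h k hk) (by linarith) ?_ h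
      have : (0 : ℝ) ≤ m := by positivity
      linarith
    have refl : ∀ f : ℝ → ℝ, ∑ m ∈ range k, f ((k : ℝ) - m) = ∑ m ∈ range k, f ((m : ℝ) + 1) := by
      intro f
      rw [← sum_range_reflect]
      refine sum_congr rfl fun m hm => ?_
      have hm' : m + 1 ≤ k := by simpa using hm
      have : k - 1 - m = k - (m + 1) := by omega
      rw [this, Nat.cast_sub hm']; push_cast; congr 1; ring
    have h2 : ∑ m ∈ range k, (-l.re * (1 / ((k : ℝ) - m)) + C * (1 / ((k : ℝ) - m) ^ 2 + 1 / ((m : ℝ) + 3 / 2) ^ 2))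
        ≤ -l.re * Real.log ((k : ℝ) + 1) + C * (B + B) := by
      rw [sum_add_distrib, ← mul_sum, ← mul_sum, sum_add_distrib, refl (fun x => 1 / x), refl (fun x => 1 / x ^ 2)]
      have a1 := mul_le_mul_of_nonneg_left (log_le_sum k) h.le
      have a2 : ∑ m ∈ range k, 1 / ((m : ℝ) + 3 / 2) ^ 2 ≤ B := by
        refine le_trans (sum_le_sum fun m _ => ?_) (hB k)
        gcongr; norm_num
      have a3 := mul_le_mul_of_nonneg_left (add_le_add (hB k) a2) hC0
      linarith
    rw [← Real.exp_sum] at h1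
    have h3 := h1.trans (Real.exp_le_exp.2 h2)
    have h4 : ‖3 / ((k : ℂ) + 1 / 2) - 1 / (k + l)‖ ≤ 8 / ((k : ℝ) + 1) := by
      refine (norm_sub_le _ _).trans ?_
      have b1 : ‖3 / ((k : ℂ) + 1 / 2)‖ ≤ 6 / ((k : ℝ) + 1) := by
        have : 3 / ((k : ℂ) + 1 / 2) = ((3 / ((k : ℝ) + 1 / 2) : ℝ) : ℂ) := by push_cast; rfl
        rw [this, Complex.norm_real, Real.norm_of_nonneg (by positivity),
          div_le_div_iff₀ (by positivity) (by positivity)]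
        linarith
      have b2 : ‖1 / ((k : ℂ) + l)‖ ≤ 2 / ((k : ℝ) + 1) := by
        have := norm_ge l h k
        rw [norm_div, norm_one, div_le_div_iff₀ (by linarith) (by positivity)]
        linarith
      have : 8 / ((k : ℝ) + 1) = 6 / ((k : ℝ) + 1) + 2 / ((k : ℝ) + 1) := by ring
      rw [this]; exact add_le_add b1 b2
    refine (mul_le_mul h3 h4 (norm_nonneg _) (Real.exp_pos _).le).trans (le_of_eq ?_)
    rw [Real.exp_add, Real.rpow_add (by positivity), Real.rpow_one, Real.rpow_def_of_pos (by positivity)]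
    rw [neg_mul, Real.exp_neg, mul_comm l.re]
    have := Real.exp_pos (Real.log ((k : ℝ) + 1) * l.re)
    field_simp
  refine hle.trans ?_
  have : 0 ≤ ‖TT l 0‖ * (1 / ((k : ℝ) + 1) ^ (1 + l.re)) := by positivity
  linarith

lemma DD_bound (l : ℂ) (h : 0 < l.re) : ∃ K : ℝ, 0 ≤ K ∧ ∀ k n : ℕ, 1 ≤ k → 1 ≤ n →
    (n : ℝ) * (n + k + 3 / 2) ≤ Real.exp (K / (n : ℝ) ^ 2) * ‖DD l k n‖ := by
  set κ := ‖l‖ ^ 2 + ‖(l - 1 / 2) ^ 3‖ with hKdef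
  have hκ : 0 ≤ κ := by positivity
  set W := 2 * (2 * κ + ‖l‖) with hW
  have hW0 : 0 ≤ W := by positivity
  refine ⟨2 * κ + 2 * κ * W, by positivity, fun k n hk hn => ?_⟩
  have hk' : (1 : ℝ) ≤ k := by exact_mod_cast hk
  have hn' : (1 : ℝ) ≤ n := by exact_mod_cast hn
  set X : ℝ := (n : ℝ) * (n + k + 3 / 2) with hX
  have hX0 : 0 < X := by positivity
  have hnX : (n : ℝ) ^ 2 ≤ X := by rw [hX]; nlinarith
  have hkX : (k : ℝ) ≤ X := by rw [hX]; nlinarith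
  have hn2 : (0 : ℝ) < (n : ℝ) ^ 2 := by positivity
  by_cases hc : 2 * κ ≤ X
  · have h1 : X - κ ≤ ‖DD l k n‖ := by
      have h2 := Complex.re_le_norm (DD l k n)
      have e : DD l k n = ((X : ℝ) : ℂ) + (((k : ℝ) + 3 / 2 : ℝ) : ℂ) * l - (l ^ 2 - (l - 1 / 2) ^ 3 / (k + l)) := by
        rw [hX]; unfold DD; push_cast; ring
      rw [e, Complex.sub_re, Complex.add_re, Complex.re_ofReal_mul, Complex.ofReal_re, ← e] at h2
      have h3 := (Complex.re_le_norm _).trans (kap l h k hk)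
      have h4 : 0 < ((k : ℝ) + 3 / 2) * l.re := by positivity
      linarith
    set y := κ / X with hy
    have hy0 : 0 ≤ y := by positivity
    have hy1 : y ≤ 1 / 2 := by rw [hy, div_le_iff₀ hX0]; linarith
    have hyX : κ = y * X := by rw [hy]; field_simp
    have h5 : 1 + 2 * y ≤ Real.exp ((2 * κ + 2 * κ * W) / (n : ℝ) ^ 2) := by
      have := Real.add_one_le_exp ((2 * κ + 2 * κ * W) / (n : ℝ) ^ 2)
      have h6 : 2 * y ≤ (2 * κ + 2 * κ * W) / (n : ℝ) ^ 2 := by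
        rw [hy, ← mul_div_assoc]
        have : 0 ≤ 2 * κ * W := by positivity
        gcongr
        linarith
      linarith
    have h7 : X ≤ (1 + 2 * y) * (X - κ) := by
      rw [hyX]
      have : 0 ≤ (y * (1 - 2 * y)) * X := mul_nonneg (mul_nonneg hy0 (by linarith)) hX0.le
      nlinarith
    refine h7.trans (mul_le_mul h5 h1 ?_ (Real.exp_pos _).le)
    linarith
  · push Not at hc
    have h1 := DD_lower l h k n hk hn
    refine h1.trans (mul_le_mul_of_nonneg_right ?_ (norm_nonneg _))
    have h2 : 2 * (k + ‖l‖) ≤ W := by rw [hW]; linarith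
    have h3 : W ≤ (2 * κ + 2 * κ * W) / (n : ℝ) ^ 2 := by
      rw [le_div_iff₀ hn2]
      have : W * (n : ℝ) ^ 2 ≤ W * (2 * κ) := mul_le_mul_of_nonneg_left (by linarith) hW0
      linarith
    have := Real.add_one_le_exp ((2 * κ + 2 * κ * W) / (n : ℝ) ^ 2)
    linarith

lemma RR_bound (l : ℂ) (h : 0 < l.re) : ∃ C : ℝ, 0 ≤ C ∧ ∀ N k : ℕ, ‖RR l N k‖ ≤ C := by
  obtain ⟨B, hB0, hB⟩ := exists_sq_bound
  obtain ⟨K, hK0, hK⟩ := DD_bound l h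
  refine ⟨Real.exp (K * B), (Real.exp_pos _).le, fun N k => ?_⟩
  unfold RR
  rw [norm_prod]
  have h1 : ∀ m ∈ range k, ‖((((N - k : ℕ) : ℂ) + 1 + m) * (((N - k : ℕ) : ℂ) + 1 + m + k + 3 / 2))
    / DD l k (((N - k : ℕ) : ℂ) + 1 + m)‖ ≤ Real.exp (K * (1 / ((m : ℝ) + 1) ^ 2)) := by
    intro m hm
    have hk : 1 ≤ k := by have := mem_range.1 hm; omega
    have h2 := hK k (N - k + 1 + m) hk (by omega)
    have h3 := DD_ne l h k (N - k + 1 + m) hk (by omega)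
    have e : (((N - k : ℕ) : ℂ) + 1 + m) = ((N - k + 1 + m : ℕ) : ℂ) := by push_cast; ring
    rw [e]
    have hge : (m : ℝ) + 1 ≤ ((N - k + 1 + m : ℕ) : ℝ) := by
      have : m + 1 ≤ N - k + 1 + m := by omega
      exact_mod_cast this
    generalize N - k + 1 + m = n at *
    have e2 : (n : ℂ) * (n + k + 3 / 2) = (((n : ℝ) * (n + k + 3 / 2) : ℝ) : ℂ) := by push_cast; rfl
    rw [norm_div, e2, Complex.norm_real, Real.norm_of_nonneg (by positivity), div_le_iff₀ (norm_pos_iff.2 h3)]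
    refine h2.trans (mul_le_mul_of_nonneg_right (Real.exp_le_exp.2 ?_) (norm_nonneg _))
    rw [mul_one_div]
    gcongr
  refine (prod_le_prod (fun _ _ => norm_nonneg _) h1).trans ?_
  rw [← Real.exp_sum, ← mul_sum]
  exact Real.exp_le_exp.2 (mul_le_mul_of_nonneg_left (hB k) hK0)

lemma RR_tendsto (l : ℂ) (k : ℕ) : Tendsto (fun N => RR l N k) atTop (𝓝 1) := by
  have hf : Tendsto (fun i : ℕ => ((i : ℂ) * (i + k + 3 / 2)) / DD l k i) atTop (𝓝 1) := by
    set c : ℂ := k + 3 / 2 with hc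
    set w : ℂ := (l - 1 / 2) ^ 3 / (k + l) with hw
    let g : ℂ → ℂ := fun u => (1 + c * u) / ((1 + l * u) * (1 + (c - l) * u) + w * u ^ 2)
    have hg : ContinuousAt g 0 := by
      refine ContinuousAt.div (by fun_prop) (by fun_prop) (by simp)
    have hg0 : g 0 = 1 := by simp [g]
    have h1 := hg.tendsto.comp (tendsto_inv_atTop_nhds_zero_nat (𝕜 := ℂ))
    rw [hg0] at h1
    refine h1.congr' ?_
    filter_upwards [eventually_gt_atTop 0] with i hi
    have hi' : (i : ℂ) ≠ 0 := by exact_mod_cast hi.ne'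
    simp only [Function.comp, g]
    have e1 : 1 + c * (i : ℂ)⁻¹ = ((i : ℂ) * (i + k + 3 / 2)) / (i : ℂ) ^ 2 := by
      rw [hc]; field_simp; ring
    have e2 : (1 + l * (i : ℂ)⁻¹) * (1 + (c - l) * (i : ℂ)⁻¹) + w * (i : ℂ)⁻¹ ^ 2 = DD l k i / (i : ℂ) ^ 2 := by
      unfold DD; rw [← hw, hc]; generalize w = w'; field_simp; ring
    rw [e1, e2, div_div_div_cancel_right₀ (pow_ne_zero _ hi')]
  have : Tendsto (fun N => RR l N k) atTop (𝓝 (∏ m ∈ range k, (1 : ℂ))) := by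
    refine tendsto_finsetProd _ fun m _ => ?_
    have ht : Tendsto (fun N : ℕ => N - k + 1 + m) atTop atTop := by
      refine tendsto_atTop_mono (f := fun N => N - k) (fun N => by omega) (tendsto_sub_atTop_nat k)
    refine (hf.comp ht).congr fun N => ?_
    simp only [Function.comp]
    push_cast
    rfl
  simpa using this

lemma wallis_lim : Tendsto (fun N : ℕ => ((N.factorial : ℂ) / poch (3 / 2) (N + 1)) *
      (∏ j ∈ range (N + 1), ((j : ℂ) + 1) ^ 3 / ((j : ℂ) + 1 / 2) ^ 3)) atTop
      (𝓝 ((Real.pi : ℂ) ^ 2 / 2)) := by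
  have e : ∀ N : ℕ, ((N.factorial : ℂ) / poch (3 / 2) (N + 1)) *
      (∏ j ∈ range (N + 1), ((j : ℂ) + 1) ^ 3 / ((j : ℂ) + 1 / 2) ^ 3)
      = ((Real.Wallis.W (N + 1) ^ 2 * (2 + 1 / ((N : ℝ) + 1)) : ℝ) : ℂ) := by
    intro N
    induction N with
    | zero => simp [poch, Real.Wallis.W]; norm_num
    | succ N ih =>
      rw [Real.Wallis.W_succ, prod_range_succ, poch, prod_range_succ, ← poch, Nat.factorial_succ]
      have e1 : (((N + 1) * N.factorial : ℕ) : ℂ) / (poch (3 / 2) (N + 1) * (3 / 2 + ((N + 1 : ℕ) : ℂ)))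
        * ((∏ j ∈ range (N + 1), ((j : ℂ) + 1) ^ 3 / ((j : ℂ) + 1 / 2) ^ 3) * ((((N + 1 : ℕ) : ℂ) + 1) ^ 3 / (((N + 1 : ℕ) : ℂ) + 1 / 2) ^ 3))
        = (((N.factorial : ℂ) / poch (3 / 2) (N + 1)) *
      (∏ j ∈ range (N + 1), ((j : ℂ) + 1) ^ 3 / ((j : ℂ) + 1 / 2) ^ 3)) * ((((N : ℝ) + 1) / (3 / 2 + (N + 1)) * (((N : ℝ) + 1 + 1) ^ 3 / ((N : ℝ) + 1 + 1 / 2) ^ 3) : ℝ) : ℂ) := by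
        push_cast
        generalize ∏ j ∈ range (N + 1), ((j : ℂ) + 1) ^ 3 / ((j : ℂ) + 1 / 2) ^ 3 = P
        generalize (3 / 2 : ℂ) + (N + 1) = y
        generalize ((N : ℂ) + 1 + 1) ^ 3 / ((N : ℂ) + 1 + 1 / 2) ^ 3 = z
        ring
      rw [e1, ih, ← Complex.ofReal_mul]
      congr 1
      push_cast
      generalize Real.Wallis.W (N + 1) = w
      field_simp
      ring
  have h1 : Tendsto (fun N : ℕ => Real.Wallis.W (N + 1) ^ 2 * (2 + 1 / ((N : ℝ) + 1))) atTop (𝓝 ((Real.pi / 2) ^ 2 * (2 + 0))) :=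
    ((Real.Wallis.tendsto_W_nhds_pi_div_two.comp (tendsto_add_atTop_nat 1)).pow 2).mul
      (tendsto_const_nhds.add tendsto_one_div_add_atTop_nhds_zero_nat)
  have h2 := (Complex.continuous_ofReal.tendsto _).comp h1
  have e3 : (((Real.pi / 2) ^ 2 * (2 + 0) : ℝ) : ℂ) = (Real.pi : ℂ) ^ 2 / 2 := by push_cast; ring
  rw [e3] at h2
  exact h2.congr fun N => (e N).symm

lemma vanish_lim (l : ℂ) (h : 0 < l.re) :
    Tendsto (fun N : ℕ => ((N.factorial : ℂ) / poch (3 / 2) (N + 1)) *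
      (∏ j ∈ range (N + 1), ((j : ℂ) + 3 / 2 - l) / (j + l))) atTop (𝓝 0) := by
  obtain ⟨B, hB0, hB⟩ := exists_sq_bound
  have hl0 : 0 < ‖l‖ := norm_pos_iff.2 (by rintro rfl; simp at h)
  have e : ∀ N : ℕ, ((N.factorial : ℂ) / poch (3 / 2) (N + 1)) *
      (∏ j ∈ range (N + 1), ((j : ℂ) + 3 / 2 - l) / (j + l))
      = (∏ j ∈ range (N + 1), (1 + ((-(1 / ((j : ℝ) + 3 / 2)) : ℝ) : ℂ) * l)) * ((∏ j ∈ range N, (((j : ℂ) + 1) / (((j + 1 : ℕ) : ℂ) + l))) / l) := by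
    intro N
    have e1 : (∏ j ∈ range (N + 1), (1 + ((-(1 / ((j : ℝ) + 3 / 2)) : ℝ) : ℂ) * l))
       = (∏ j ∈ range (N + 1), ((j : ℂ) + 3 / 2 - l)) / poch (3 / 2) (N + 1) := by
      rw [poch, ← prod_div_distrib]
      refine prod_congr rfl fun j _ => ?_
      have m2 : ((3 / 2 : ℂ) + j) ≠ 0 := by
        have := half_ne (j + 1)
        push_cast at this
        intro h; apply this; rw [← h]; ring
      have e3 : (j : ℂ) + 3 / 2 = 3 / 2 + j := by ring
      push_cast
      rw [e3]
      generalize (3 / 2 : ℂ) + j = q at *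
      field_simp
      ring
    have e2 : (∏ j ∈ range (N + 1), ((j : ℂ) + l)) = (∏ j ∈ range N, (((j + 1 : ℕ) : ℂ) + l)) * l := by
      rw [prod_range_succ']; simp
    rw [e1, prod_div_distrib, prod_div_distrib, e2, ← prod_range_add_one_eq_factorial]
    push_cast
    rw [div_div, div_mul_div_comm, div_mul_div_comm, mul_comm (∏ x ∈ range N, ((x : ℂ) + 1))]
  have bd : ∀ N : ℕ, ‖((N.factorial : ℂ) / poch (3 / 2) (N + 1)) *
      (∏ j ∈ range (N + 1), ((j : ℂ) + 3 / 2 - l) / (j + l))‖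
      ≤ Real.exp (-(l.re / 2 * Real.log ((N : ℝ) + 2))) * (Real.exp (‖l‖ ^ 2 * B) * (1 / ‖l‖)) := by
    intro N
    rw [e, norm_mul, norm_div, norm_prod, norm_prod, ← mul_assoc, ← Real.exp_add]
    refine mul_le_mul ?_ ?_ (by positivity) (Real.exp_pos _).le
    · have h1 : ∀ j ∈ range (N + 1), ‖(1 + ((-(1 / ((j : ℝ) + 3 / 2)) : ℝ) : ℂ) * l)‖
         ≤ Real.exp (-(l.re / 2) * (1 / ((j : ℝ) + 1)) + ‖l‖ ^ 2 * (1 / ((j : ℝ) + 1) ^ 2)) := by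
        intro j _
        refine (norm_one_add_le _).trans (Real.exp_le_exp.2 ?_)
        rw [Complex.re_ofReal_mul, norm_mul, Complex.norm_real, norm_neg, Real.norm_of_nonneg (by positivity), mul_pow]
        have a1 : 1 / ((j : ℝ) + 3 / 2) ≤ 1 / ((j : ℝ) + 1) := by gcongr; norm_num
        have a2 : 1 / ((j : ℝ) + 1) ≤ 2 * (1 / ((j : ℝ) + 3 / 2)) := by
          rw [mul_one_div, div_le_div_iff₀ (by positivity) (by positivity)]
          have : (0 : ℝ) ≤ j := by positivity
          linarith
        have a3 := mul_le_mul_of_nonneg_left a2 h.le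
        have a4 : (1 / ((j : ℝ) + 3 / 2)) ^ 2 ≤ (1 / ((j : ℝ) + 1)) ^ 2 := by gcongr
        have a5 := mul_le_mul_of_nonneg_right a4 (sq_nonneg ‖l‖)
        have a6 : 1 / ((j : ℝ) + 1) ^ 2 = (1 / ((j : ℝ) + 1)) ^ 2 := by rw [div_pow, one_pow]
        rw [a6]
        have a7 : 0 ≤ (1 / ((j : ℝ) + 3 / 2)) ^ 2 * ‖l‖ ^ 2 := by positivity
        linarith
      refine (prod_le_prod (fun _ _ => norm_nonneg _) h1).trans ?_
      rw [← Real.exp_sum, sum_add_distrib, ← mul_sum, ← mul_sum]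
      refine Real.exp_le_exp.2 ?_
      have b1 := log_le_sum (N + 1)
      have b2 := mul_le_mul_of_nonneg_left b1 (by linarith : 0 ≤ l.re / 2)
      have b3 := mul_le_mul_of_nonneg_left (hB (N + 1)) (sq_nonneg ‖l‖)
      have b4 : (((N + 1 : ℕ) : ℝ) + 1) = (N : ℝ) + 2 := by push_cast; ring
      rw [b4] at b2
      linarith
    · gcongr
      refine prod_le_one (fun _ _ => norm_nonneg _) fun j _ => ?_
      have := norm_ge l h (j + 1)
      rw [norm_div, div_le_one (by have : (0 : ℝ) < ((j + 1 : ℕ) : ℝ) := by positivity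
                                   linarith)]
      refine le_trans (le_of_eq ?_) this
      have e5 : (j : ℂ) + 1 = ((j + 1 : ℕ) : ℂ) := by push_cast; rfl
      rw [e5, Complex.norm_natCast]
  refine squeeze_zero_norm bd ?_
  have h1 : Tendsto (fun N : ℕ => l.re / 2 * Real.log ((N : ℝ) + 2)) atTop atTop := by
    refine Tendsto.const_mul_atTop (by linarith) (Real.tendsto_log_atTop.comp ?_)
    exact tendsto_atTop_add_const_right _ _ tendsto_natCast_atTop_atTop
  have h2 := (Real.tendsto_exp_neg_atTop_nhds_zero.comp h1).mul_const (Real.exp (‖l‖ ^ 2 * B) * (1 / ‖l‖))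
  rw [zero_mul] at h2
  exact h2

lemma main_sum (l : ℂ) (h : 0 < l.re) : HasSum (TT l) ((Real.pi : ℂ) ^ 2 / 2) := by
  obtain ⟨C, hC⟩ := TT_bound l h
  obtain ⟨R, hR0, hR⟩ := RR_bound l h
  have hs : Summable (fun k : ℕ => C * (1 / ((k : ℝ) + 1) ^ (1 + l.re))) := by
    refine Summable.mul_left _ ?_
    have := (summable_nat_add_iff 1).2 (Real.summable_one_div_nat_rpow.2 (by linarith : 1 < 1 + l.re))
    simpa using this
  have hT : Summable (TT l) := Summable.of_norm_bounded hs hC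
  let f : ℕ → ℕ → ℂ := fun N k => if k ∈ range (N + 1) then TT l k * RR l N k else 0
  have h1 : Tendsto (fun N => ∑' k, f N k) atTop (𝓝 (∑' k, TT l k)) := by
    refine tendsto_tsum_of_dominated_convergence (hs.mul_right R) ?_ (Eventually.of_forall fun N k => ?_)
    · intro k
      have := (RR_tendsto l k).const_mul (TT l k)
      rw [mul_one] at this
      refine this.congr' ?_
      filter_upwards [eventually_ge_atTop k] with N hN
      simp only [f]
      rw [if_pos (mem_range.2 (by omega))]
    · simp only [f]
      split_ifs
      · rw [norm_mul]
        exact mul_le_mul (hC k) (hR N k) (norm_nonneg _) ((norm_nonneg _).trans (hC k))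
      · rw [norm_zero]
        exact mul_nonneg ((norm_nonneg _).trans (hC k)) hR0
  have h2 : ∀ N, ∑' k, f N k = ((N.factorial : ℂ) / poch (3 / 2) (N + 1)) *
      (∏ j ∈ range (N + 1), ((j : ℂ) + 1) ^ 3 / ((j : ℂ) + 1 / 2) ^ 3)
        - ((N.factorial : ℂ) / poch (3 / 2) (N + 1)) * ∏ j ∈ range (N + 1), ((j : ℂ) + 3 / 2 - l) / (j + l) := by
    intro N
    rw [← mul_sub, ← fin_id l h N, tsum_eq_sum (s := range (N + 1)) (fun k hk => if_neg hk)]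
    exact sum_congr rfl fun k hk => if_pos hk
  have h3 := wallis_lim.sub (vanish_lim l h)
  rw [sub_zero] at h3
  have h4 := tendsto_nhds_unique (h1.congr h2) h3
  rw [← h4]
  exact hT.hasSum

/-- The family of series for π²/2 from Section 5. -/
theorem pi_squared_family (lam : ℂ) (hre : 0 < lam.re)
    (hlam : ∀ m : ℕ, lam ≠ -(m : ℂ))
    (ξp ξm : ℕ → ℂ)
    (hξ : ∀ k : ℕ, ξp k + ξm k = 1 / 2 - (k : ℂ)
      ∧ ξp k * ξm k = ((1 / 2 - (k : ℂ)) / 2) ^ 2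
          - ((2 * (k : ℂ) + 1) / 4) ^ 2 * (((k : ℂ) + 2 - 3 * lam) / ((k : ℂ) + lam))) :
    Tendsto (fun N : ℕ => ∑ k ∈ Finset.range N,
        ((-1 : ℂ) ^ k * poch (ξp k) k * poch (ξm k) k
            / ((k.factorial : ℂ) * poch (3 / 2) k))
        * (6 / (2 * (k : ℂ) + 1) - 1 / (lam + k)))
      atTop
      (𝓝 ((Real.pi : ℂ) ^ 2 / 2)) := by
  refine (main_sum lam hre).tendsto_sum_nat.congr fun N => sum_congr rfl fun k _ => ?_
  unfold TT
  rw [mul_assoc ((-1 : ℂ) ^ k) (poch _ _) (poch _ _),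
    poch_DD lam k (ne_of_re lam hre k) _ _ (hξ k).1 (hξ k).2, add_comm lam]
  have e : (6 : ℂ) / (2 * k + 1) = 3 / ((k : ℂ) + 1 / 2) := by
    have h1 := half_ne k
    have h2 : (2 * k + 1 : ℂ) = 2 * ((k : ℂ) + 1 / 2) := by ring
    rw [h2]
    generalize (k : ℂ) + 1 / 2 = x at *
    field_simp; norm_num
  rw [e]
end
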